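/- arXiv:1109.5330 — 5 statements merged into one kernel-verified Lean document; each statement's English description precedes it below -/
import Mathlib

section
/- An integral domain D is quasi-Prüfer if and only if D is residually algebraic, i.e., for every overring T of D and every prime ideal Q of T, the residue field of T at Q is algebraic over the residue field of D at Q ∩ D. -/
set_option synthInstance.maxHeartbeats 1000000
set_option maxHeartbeats 1000000

open Polynomial

/-- `D` is a quasi-Prüfer domain: for each prime `P` of `D` and each prime `Q` of `D[X]`
with `Q ⊆ P[X]`, one has `Q = (Q ∩ D)[X]`. -/
def IsQuasiPrufer (D : Type*) [CommRing D] : Prop :=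
  ∀ P : Ideal D, P.IsPrime → ∀ Q : Ideal D[X], Q.IsPrime →
    Q ≤ P.map (C : D →+* D[X]) → Q = (Q.comap (C : D →+* D[X])).map (C : D →+* D[X])

/-- `D` is a Prüfer domain: every nonzero finitely generated ideal is invertible
(as a fractional ideal in the fraction field). -/
def IsPruferDom (D : Type*) [CommRing D] [IsDomain D] : Prop :=
  ∀ I : Ideal D, I ≠ ⊥ → I.FG →
    IsUnit (I : FractionalIdeal (nonZeroDivisors D) (FractionRing D))

/-- The valuative dimension of a domain: the supremum of the Krull dimensions of its
valuation overrings. -/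
noncomputable def valuativeDim (R : Type*) [CommRing R] [IsDomain R] : WithBot ℕ∞ :=
  ⨆ (V : Subalgebra R (FractionRing R)) (_ : ValuationRing V), ringKrullDim V

/-- `P₁ ⊊ P₂` are adjacent primes: both prime, `P₁ < P₂`, and no prime strictly between. -/
def AdjacentPrimes {R : Type*} [CommRing R] (P₁ P₂ : Ideal R) : Prop :=
  P₁.IsPrime ∧ P₂.IsPrime ∧ P₁ < P₂ ∧ ∀ Q : Ideal R, Q.IsPrime → P₁ < Q → ¬ Q < P₂

/-- `D` is a strong S-domain: adjacent primes `P₁ ⊊ P₂` extend to adjacent primes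
`P₁[X] ⊊ P₂[X]` of `D[X]`. -/
def IsStrongS (D : Type*) [CommRing D] : Prop :=
  ∀ P₁ P₂ : Ideal D, AdjacentPrimes P₁ P₂ →
    AdjacentPrimes (P₁.map (C : D →+* D[X])) (P₂.map (C : D →+* D[X]))

/-- Transcendence degree: the supremum of cardinalities of algebraically independent
subsets. -/
noncomputable def trdeg (F E : Type*) [CommRing F] [CommRing E] [Algebra F E] : Cardinal :=
  ⨆ s : {s : Set E // AlgebraicIndependent F ((↑) : s → E)}, Cardinal.mk s.1

section Pullback

variable (D : Type*) [CommRing D] [IsDomain D] (T : Subalgebra D (FractionRing D))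
  (Q : Ideal T) [Q.IsPrime]

instance : IsDomain (Localization.AtPrime Q) :=
  IsLocalization.isDomain_localization Q.primeCompl_le_nonZeroDivisors

/-- The copy of the residue field `k(q) = Frac(D/q)` (where `q = Q ∩ D`) inside the residue
field `k(Q) = T_Q/QT_Q`: the subfield generated by the image of `D`. -/
noncomputable def kqSub : Subfield (IsLocalRing.ResidueField (Localization.AtPrime Q)) :=
  Subfield.closure (Set.range ((IsLocalRing.residue (Localization.AtPrime Q)).comp
    ((algebraMap T (Localization.AtPrime Q)).comp (algebraMap D T))))

/-- The pullback ring `D(Q) = D_q + QT_Q`: the preimage of `k(q) ⊆ k(Q)` under the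
canonical surjection `T_Q → k(Q)`. -/
noncomputable def DQ : Subring (Localization.AtPrime Q) :=
  (kqSub D T Q).toSubring.comap (IsLocalRing.residue (Localization.AtPrime Q))

end Pullback
/-- Over a residually algebraic domain `D`, any homomorphism from a `D`-subalgebra of the quotient
field to a field takes values that satisfy a nontrivial polynomial over the image of `D`. -/
lemma isAlgebraic_range_of_residuallyAlgebraic {D A F : Type*} [CommRing D] [IsDomain D]
    [CommRing A] [Algebra D A] [Field F]
    (H : ∀ T : Subalgebra D (FractionRing D), ∀ Q : Ideal T, Q.IsPrime →
        ∀ x : ↥T ⧸ Q, ∃ p : Polynomial (D ⧸ Q.comap (algebraMap D ↥T)), p ≠ 0 ∧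
          Polynomial.eval₂ (Ideal.quotientMap Q (algebraMap D ↥T) le_rfl) x p = 0)
    (j : A →ₐ[D] FractionRing D) (hj : Function.Injective j) (φ : A →+* F) (x : A) :
    IsAlgebraic (φ.comp (algebraMap D A)).range (φ x) := by
  let e := AlgEquiv.ofInjective j hj
  let φ' : j.range →+* F := φ.comp (e.symm : j.range →+* A)
  have hφ' (a : A) : φ' (e a) = φ a := by simp [φ']
  have hφD (d : D) : φ' (algebraMap D j.range d) = φ (algebraMap D A d) := by
    rw [← e.commutes, hφ']
  obtain ⟨p, hp, hpx⟩ := H j.range (RingHom.ker φ') (RingHom.ker_isPrime φ')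
    (Ideal.Quotient.mk _ (e x))
  obtain ⟨p, rfl⟩ := Polynomial.map_surjective _ Ideal.Quotient.mk_surjective p
  refine ⟨p.map (φ.comp (algebraMap D A)).rangeRestrict, fun h ↦ hp ?_, ?_⟩
  · ext n
    have h1 := congrArg (fun q ↦ ((q.coeff n : (φ.comp (algebraMap D A)).range) : F)) h
    simp only [coeff_map, coeff_zero, RingHom.coe_rangeRestrict, RingHom.comp_apply,
      ZeroMemClass.coe_zero] at h1
    rw [coeff_map, coeff_zero, Ideal.Quotient.eq_zero_iff_mem, Ideal.mem_comap, RingHom.mem_ker,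
      hφD, h1]
  · rw [eval₂_map, Ideal.quotientMap_comp_mk, ← hom_eval₂, Ideal.Quotient.eq_zero_iff_mem,
      RingHom.mem_ker, hom_eval₂, hφ'] at hpx
    rw [aeval_def, eval₂_map]
    have hcomp : (algebraMap (φ.comp (algebraMap D A)).range F).comp
        (φ.comp (algebraMap D A)).rangeRestrict = φ'.comp (algebraMap D j.range) :=
      RingHom.ext fun d ↦ (hφD d).symm
    rwa [hcomp]

/-- A root of a nontrivial polynomial relation with algebraic coefficients is algebraic. -/
lemma isAlgebraic_of_sum_eq_zero {R F : Type*} [CommRing R] [IsDomain R] [Field F] [Algebra R F]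
    {s : Finset ℕ} {c : ℕ → F} {y : F} (hc : ∀ i, IsAlgebraic R (c i)) {k : ℕ} (hks : k ∈ s)
    (hk : c k ≠ 0) (h : ∑ i ∈ s, c i * y ^ i = 0) : IsAlgebraic R y := by
  let S := Subalgebra.algebraicClosure R F
  refine IsAlgebraic.restrictScalars R (S := S)
    ⟨∑ i ∈ s, monomial i (⟨c i, hc i⟩ : S), fun h0 ↦ hk ?_, ?_⟩
  · have h1 := congrArg (fun q ↦ ((q.coeff k : S) : F)) h0
    simpa [finsetSum_coeff, coeff_monomial, hks] using h1
  · simpa [aeval_monomial] using h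

/-- For primes `P` of `D` and `Q ⊆ P[X]` of `D[X]`, there is a valuation ring `W` of a field
containing `D[X] ⧸ Q` whose center on `D[X]` is `P[X]`. -/
lemma exists_valuationSubring_center_eq {D : Type*} [CommRing D] (P : Ideal D) [P.IsPrime]
    (Q : Ideal D[X]) [Q.IsPrime] (hQP : Q ≤ P.map (C : D →+* D[X])) :
    ∃ (W : ValuationSubring Q.ResidueField)
      (hW : ∀ f : D[X], algebraMap D[X] Q.ResidueField f ∈ W.toSubring),
      ∀ f : D[X], IsLocalRing.residue W
        ((algebraMap D[X] Q.ResidueField).codRestrict W.toSubring hW f) = 0 ↔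
          f ∈ P.map (C : D →+* D[X]) := by
  let P' : Ideal D[X] := P.map C
  have hunit (f : P'.primeCompl) : IsUnit (algebraMap D[X] Q.ResidueField f) := by
    rw [isUnit_iff_ne_zero, Ne, Ideal.algebraMap_residueField_eq_zero]
    exact fun h ↦ f.2 (hQP h)
  let g : Localization.AtPrime P' →+* Q.ResidueField := IsLocalization.lift hunit
  have hg (f : D[X]) : g (algebraMap _ _ f) = algebraMap D[X] Q.ResidueField f :=
    IsLocalization.lift_eq hunit f
  obtain ⟨W, hW, hloc⟩ := IsLocalRing.exists_factor_valuationRing g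
  refine ⟨W, fun f ↦ hg f ▸ hW _, fun f ↦ ?_⟩
  have key : (algebraMap D[X] Q.ResidueField).codRestrict W.toSubring (fun f ↦ hg f ▸ hW _) f =
      g.codRestrict W.toSubring hW (algebraMap _ _ f) := Subtype.ext (hg f).symm
  rw [key, IsLocalRing.residue_eq_zero_iff, IsLocalRing.mem_maximalIdeal, mem_nonunits_iff]
  rw [isUnit_map_iff (g.codRestrict W.toSubring hW)]
  rw [IsLocalization.AtPrime.isUnit_to_map_iff (Localization.AtPrime P') P' f]
  exact not_not

/-- A residually algebraic domain is quasi-Prüfer. -/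
lemma isQuasiPrufer_of_residuallyAlgebraic {D : Type*} [CommRing D] [IsDomain D]
    (H : ∀ T : Subalgebra D (FractionRing D), ∀ Q : Ideal T, Q.IsPrime →
        ∀ x : ↥T ⧸ Q, ∃ p : Polynomial (D ⧸ Q.comap (algebraMap D ↥T)), p ≠ 0 ∧
          Polynomial.eval₂ (Ideal.quotientMap Q (algebraMap D ↥T) le_rfl) x p = 0) :
    IsQuasiPrufer D := by
  intro P hP Q hQ hQP
  refine le_antisymm (fun f hf ↦ ?_) (Ideal.map_comap_le)
  by_contra hfq
  obtain ⟨W, hW, hWP⟩ := exists_valuationSubring_center_eq P Q hQP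
  let θ : D[X] →+* Q.ResidueField := algebraMap D[X] Q.ResidueField
  let ρ : W →+* IsLocalRing.ResidueField W := IsLocalRing.residue W
  let θW : D[X] →+* W := θ.codRestrict W.toSubring hW
  let ψ : D →+* IsLocalRing.ResidueField W := (ρ.comp θW).comp C
  let y : W := θW X
  -- The residue of `X` is transcendental over the image of `D`.
  have htr : ¬ IsAlgebraic ψ.range (ρ y) := by
    rintro ⟨p, hp, hpy⟩
    obtain ⟨p, rfl⟩ := Polynomial.map_surjective _ ψ.rangeRestrict_surjective p
    refine hp ?_
    rw [aeval_def, eval₂_map] at hpy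
    have h1 : ρ (θW p) = 0 := by
      rw [← hpy]
      conv_lhs => rw [← eval₂_C_X (p := p), hom_eval₂, hom_eval₂]
      rfl
    have h2 := (hWP p).1 h1
    ext n
    have h3 := (hWP (C (p.coeff n))).2
      (Ideal.mem_map_of_mem C (Ideal.mem_map_C_iff.1 h2 n))
    rw [coeff_map, coeff_zero]
    exact h3
  -- Choose a coefficient of `f` of maximal value.
  obtain ⟨n, hn⟩ : ∃ n, C (f.coeff n) ∉ Q := by
    by_contra! h
    exact hfq (Ideal.mem_map_C_iff.2 h)
  have hfn : n ∈ f.support := mem_support_iff.2 fun h ↦ hn (by simp [h])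
  obtain ⟨k, hks, hk⟩ := f.support.exists_max_image
    (fun i ↦ W.valuation (θ (C (f.coeff i)))) ⟨n, hfn⟩
  have hθ (g : D[X]) : θ g = 0 ↔ g ∈ Q := Ideal.algebraMap_residueField_eq_zero
  have hk0 : θ (C (f.coeff k)) ≠ 0 := fun h ↦ hn <| (hθ _).1 <| by
    have := hk n hfn
    rwa [h, map_zero, le_zero_iff, map_eq_zero] at this
  have hkQ : f.coeff k ∈ (Q.comap C).primeCompl := fun h ↦ hk0 ((hθ _).2 h)
  have hcW (i : ℕ) : θ (C (f.coeff i)) / θ (C (f.coeff k)) ∈ W := by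
    rw [← W.valuation_le_one_iff, map_div₀]
    refine div_le_one_of_le₀ ?_ zero_le
    by_cases hi : i ∈ f.support
    · exact hk i hi
    · simp [notMem_support_iff.1 hi]
  -- The pullback of `W` to the localization of `D` at `Q ∩ D`.
  let A := Localization.AtPrime (Q.comap C)
  have hunit (s : (Q.comap C).primeCompl) : IsUnit (θ.comp C s) := by
    rw [isUnit_iff_ne_zero]
    exact fun h ↦ s.2 ((hθ _).1 h)
  let h : A →+* Q.ResidueField := IsLocalization.lift hunit
  have hhD (d : D) : h (algebraMap D A d) = θ (C d) := IsLocalization.lift_eq hunit d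
  let A' : Subalgebra D A :=
    { W.toSubring.comap h with
      algebraMap_mem' := fun d ↦ by
        change h (algebraMap D A d) ∈ W.toSubring
        rw [hhD]
        exact hW _ }
  let φW : A' →+* W := (h.comp A'.val.toRingHom).codRestrict W.toSubring fun a ↦ a.2
  let j₀ : A →ₐ[D] FractionRing D :=
    IsLocalization.liftAlgHom (M := (Q.comap C).primeCompl) (f := Algebra.ofId D (FractionRing D))
      fun s ↦ by
        rw [isUnit_iff_ne_zero]
        intro h0
        have : (s : D) = 0 := (IsFractionRing.injective D (FractionRing D)) (by simpa using h0)
        exact s.2 (this ▸ zero_mem _)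
  have hj₀ : Function.Injective j₀ := by
    have : IsDomain A :=
      IsLocalization.isDomain_localization (Q.comap C).primeCompl_le_nonZeroDivisors
    rw [injective_iff_map_eq_zero]
    intro a ha
    obtain ⟨a, s, rfl⟩ := IsLocalization.exists_mk'_eq (Q.comap C).primeCompl a
    have h1 : j₀ (algebraMap D A a) = 0 := by
      rw [← IsLocalization.mk'_spec A a s, map_mul, ha, zero_mul]
    rw [AlgHom.commutes, FaithfulSMul.algebraMap_eq_zero_iff] at h1
    simp [h1]
  have halg (a : A') : IsAlgebraic ψ.range (ρ (φW a)) := by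
    have := isAlgebraic_range_of_residuallyAlgebraic H (j₀.comp A'.val)
      (hj₀.comp Subtype.val_injective) (ρ.comp φW) a
    have hψ : (ρ.comp φW).comp (algebraMap D A') = ψ := by
      ext d
      exact congrArg ρ (Subtype.ext (hhD d))
    rwa [hψ] at this
  let c (i : ℕ) : W := ⟨_, hcW i⟩
  have hc (i : ℕ) : IsAlgebraic ψ.range (ρ (c i)) := by
    have hm : h (IsLocalization.mk' A (f.coeff i) ⟨f.coeff k, hkQ⟩) =
        θ (C (f.coeff i)) / θ (C (f.coeff k)) := by
      rw [eq_div_iff hk0, ← hhD, ← hhD, ← map_mul]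
      exact congrArg h (IsLocalization.mk'_spec A (f.coeff i) ⟨f.coeff k, hkQ⟩)
    have hmem : IsLocalization.mk' A (f.coeff i) ⟨f.coeff k, hkQ⟩ ∈ A' := by
      change h _ ∈ W
      rw [hm]
      exact hcW i
    have hci : c i = φW ⟨_, hmem⟩ := Subtype.ext hm.symm
    rw [hci]
    exact halg _
  have hck : c k = 1 := Subtype.ext (div_self hk0)
  have hsum : ∑ i ∈ f.support, c i * y ^ i = 0 := by
    apply Subtype.ext
    have h1 : ∑ i ∈ f.support, θ (C (f.coeff i)) * θ X ^ i = 0 := by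
      rw [← (hθ f).2 hf]
      conv_rhs => rw [f.as_sum_support_C_mul_X_pow]
      simp
    have h2 : ∑ i ∈ f.support, θ (C (f.coeff i)) / θ (C (f.coeff k)) * θ X ^ i = 0 := by
      simp_rw [div_mul_eq_mul_div]
      rw [← Finset.sum_div, h1, zero_div]
    exact (map_sum W.subtype _ _).trans h2
  refine htr (isAlgebraic_of_sum_eq_zero hc hks ?_ ?_)
  · simp [hck]
  · rw [← map_zero ρ, ← hsum]
    simp

/-- A quasi-Prüfer domain is residually algebraic. -/
lemma IsQuasiPrufer.residuallyAlgebraic {D : Type*} [CommRing D] [IsDomain D]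
    (H : IsQuasiPrufer D) (T : Subalgebra D (FractionRing D)) (Q : Ideal T) (hQ : Q.IsPrime)
    (x : ↥T ⧸ Q) : ∃ p : Polynomial (D ⧸ Q.comap (algebraMap D ↥T)), p ≠ 0 ∧
      Polynomial.eval₂ (Ideal.quotientMap Q (algebraMap D ↥T) le_rfl) x p = 0 := by
  obtain ⟨t, rfl⟩ := Ideal.Quotient.mk_surjective x
  let N : Ideal D[X] := RingHom.ker (aeval (R := D) t)
  obtain ⟨f, hfN, hf⟩ : ∃ f ∈ N, f ∉ (Q.comap (algebraMap D T)).map C := by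
    by_contra! hN
    have hNC := H _ (Ideal.IsPrime.comap _) N (RingHom.ker_isPrime _) hN
    have hinj : Function.Injective (algebraMap D T) := FaithfulSMul.algebraMap_injective D T
    have h0 : N.comap C = ⊥ := by
      rw [eq_bot_iff]
      intro d hd
      have : aeval t (C d) = 0 := hd
      rw [aeval_C] at this
      exact (injective_iff_map_eq_zero _).1 hinj d this
    rw [h0, Ideal.map_bot] at hNC
    obtain ⟨a, b, hb, hab⟩ := IsFractionRing.div_surjective (A := D) (t : FractionRing D)
    have hb0 : algebraMap D (FractionRing D) b ≠ 0 :=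
      IsFractionRing.to_map_ne_zero_of_mem_nonZeroDivisors hb
    have hmem : C b * X - C a ∈ N := by
      change aeval t _ = 0
      apply Subtype.ext
      simp only [map_sub, map_mul, aeval_C, aeval_X]
      push_cast
      rw [← hab]
      change algebraMap D (FractionRing D) b * _ - algebraMap D (FractionRing D) a = 0
      rw [mul_div_cancel₀ _ hb0, sub_self]
    rw [hNC, Ideal.mem_bot] at hmem
    refine nonZeroDivisors.ne_zero hb ?_
    simpa [coeff_C] using congrArg (fun q ↦ q.coeff 1) hmem
  refine ⟨f.map (Ideal.Quotient.mk _), fun h ↦ hf (Ideal.mem_map_C_iff.2 fun n ↦ ?_), ?_⟩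
  · rw [← Ideal.Quotient.eq_zero_iff_mem, ← coeff_map, h, coeff_zero]
  · rw [eval₂_map, Ideal.quotientMap_comp_mk, ← hom_eval₂]
    have : eval₂ (algebraMap D T) t f = 0 := hfN
    rw [this, map_zero]

/-- `D` is quasi-Prüfer iff `D` is residually algebraic: for every overring `T`
and every prime `Q` of `T`, the residue field of `T` at `Q` is algebraic over the residue
field of `D` at `q = Q ∩ D` (equivalently, `T/Q` is algebraic over `D/q`). -/
theorem statement_2 (D : Type*) [CommRing D] [IsDomain D] :
    IsQuasiPrufer D ↔
      ∀ T : Subalgebra D (FractionRing D), ∀ Q : Ideal T, Q.IsPrime →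
        ∀ x : ↥T ⧸ Q, ∃ p : Polynomial (D ⧸ Q.comap (algebraMap D ↥T)), p ≠ 0 ∧
          Polynomial.eval₂ (Ideal.quotientMap Q (algebraMap D ↥T) le_rfl) x p = 0 := by
  exact ⟨fun H T Q hQ x ↦ H.residuallyAlgebraic T Q hQ x,
    isQuasiPrufer_of_residuallyAlgebraic⟩
end

section
/- Let D be a domain, T an overring of D, Q a prime ideal of T, q = Q ∩ D, and D(Q) = D_q + QT_Q the pullback ring. Then the valuative dimension satisfies dim_v(D(Q)) = dim_v(T_Q) + trdeg_{k(q)}(k(Q)), where k(q) and k(Q) are the residue fields at q and Q respectively. -/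
set_option synthInstance.maxHeartbeats 1000000
set_option maxHeartbeats 1000000

open Polynomial

universe u

namespace ValuativeDim

theorem krullDim_overring {F : Type*} [Field F] (A : ValuationSubring F) :
    Order.krullDim {S : ValuationSubring F // A ≤ S} = ringKrullDim A := by
  rw [← Order.krullDim_eq_of_orderIso A.primeSpectrumOrderEquiv, Order.krullDim_orderDual]
  rfl

theorem krullDim_valuationSubring_congr {F L : Type*} [Field F] [Field L] (e : F ≃+* L)
    {P : ValuationSubring F → Prop} {P' : ValuationSubring L → Prop}
    (h : ∀ V, P' V ↔ P (V.comap e.toRingHom)) :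
    Order.krullDim {V // P V} = Order.krullDim {V // P' V} := by
  have h1 : ∀ V : ValuationSubring F, (V.comap e.symm.toRingHom).comap e.toRingHom = V :=
    fun V ↦ by ext x; simp [ValuationSubring.mem_comap]
  have h2 : ∀ V : ValuationSubring L, (V.comap e.toRingHom).comap e.symm.toRingHom = V :=
    fun V ↦ by ext x; simp [ValuationSubring.mem_comap]
  refine Order.krullDim_eq_of_orderIso
    { toFun := fun V ↦ ⟨V.1.comap e.symm.toRingHom, (h _).2 (by rw [h1]; exact V.2)⟩
      invFun := fun V ↦ ⟨V.1.comap e.toRingHom, (h _).1 V.2⟩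
      left_inv := fun V ↦ Subtype.ext (h1 _)
      right_inv := fun V ↦ Subtype.ext (h2 _)
      map_rel_iff' := fun {V W} ↦ ⟨fun hVW x hx ↦ ?_, fun hVW x hx ↦ hVW hx⟩ }
  have := @hVW (e x) (by simpa [ValuationSubring.mem_comap] using hx)
  simpa [ValuationSubring.mem_comap] using this

theorem valuativeDim_eq_krullDim_fractionRing (R : Type*) [CommRing R] [IsDomain R] :
    valuativeDim R = Order.krullDim
      {V : ValuationSubring (FractionRing R) // ∀ r, algebraMap R (FractionRing R) r ∈ V} := by
  apply le_antisymm
  · refine iSup₂_le fun V hV ↦ ?_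
    have : IsFractionRing V (FractionRing R) :=
      IsFractionRing.of_field V (FractionRing R) fun z ↦ by
        obtain ⟨x, y, -, rfl⟩ := IsFractionRing.div_surjective (A := R) z
        exact ⟨algebraMap R V x, algebraMap R V y, rfl⟩
    let A : ValuationSubring (FractionRing R) :=
      { V.toSubring with
        mem_or_inv_mem' := fun x ↦ by
          rcases ValuationRing.isInteger_or_isInteger V x with ⟨y, hy⟩ | ⟨y, hy⟩
          · exact Or.inl (hy ▸ y.2)
          · exact Or.inr (hy ▸ y.2) }
    have h : ringKrullDim V = ringKrullDim A := rfl
    rw [h, ← krullDim_overring]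
    exact Order.krullDim_le_of_strictMono (fun W ↦ ⟨W.1, fun r ↦ W.2 (V.algebraMap_mem r)⟩)
      fun _ _ h ↦ h
  · refine iSup_le fun p ↦ ?_
    let V : Subalgebra R (FractionRing R) :=
      { p.head.1.toSubring with algebraMap_mem' := p.head.2 }
    have h : ringKrullDim V = ringKrullDim p.head.1 := rfl
    have hV : ValuationRing V := inferInstanceAs (ValuationRing p.head.1)
    refine le_trans ?_ (le_iSup₂_of_le V hV le_rfl)
    rw [h, ← krullDim_overring]
    exact Order.LTSeries.length_le_krullDim (LTSeries.mk p.length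
      (fun i ↦ (⟨(p i).1, p.head_le i⟩ : {S // p.head.1 ≤ S})) fun i j h ↦ p.strictMono h)

theorem valuativeDim_eq_krullDim (R K : Type*) [CommRing R] [IsDomain R] [Field K] [Algebra R K]
    [IsFractionRing R K] :
    valuativeDim R = Order.krullDim {V : ValuationSubring K // ∀ r, algebraMap R K r ∈ V} := by
  rw [valuativeDim_eq_krullDim_fractionRing]
  refine krullDim_valuationSubring_congr (FractionRing.algEquiv R K).toRingEquiv fun V ↦ ?_
  refine forall_congr' fun r ↦ ?_
  rw [ValuationSubring.mem_comap]
  exact iff_of_eq (congrArg (· ∈ V) ((FractionRing.algEquiv R K).commutes r).symm)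

theorem isFractionRing_subring {D S F : Type*} [CommRing D] [IsDomain D]
    {T : Subalgebra D (FractionRing D)} (Q : Ideal T) [Q.IsPrime] [CommRing S] [Algebra T S]
    [IsLocalization.AtPrime S Q] [Field F] [Algebra S F] [IsFractionRing S F] (R : Subring S)
    (hR : ∀ d : D, algebraMap T S (algebraMap D T d) ∈ R) : IsFractionRing R F := by
  have hT : ∀ t : T, ∃ a b : D, algebraMap D T b ≠ 0 ∧ t * algebraMap D T b = algebraMap D T a := by
    intro t
    obtain ⟨a, b, hb, h⟩ := IsFractionRing.div_surjective (A := D) (t : FractionRing D)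
    have hb' : algebraMap D (FractionRing D) b ≠ 0 :=
      IsFractionRing.to_map_ne_zero_of_mem_nonZeroDivisors hb
    refine ⟨a, b, fun h0 ↦ hb' (congrArg Subtype.val h0), Subtype.ext ?_⟩
    change (t : FractionRing D) * algebraMap D (FractionRing D) b = algebraMap D (FractionRing D) a
    rw [← h, div_mul_cancel₀ _ hb']
  let f : T →+* F := (algebraMap S F).comp (algebraMap T S)
  have hf : Function.Injective f := (IsFractionRing.injective S F).comp
    (IsLocalization.injective S Q.primeCompl_le_nonZeroDivisors)
  have hS : ∀ u : S, ∃ x s : T, f s ≠ 0 ∧ algebraMap S F u = f x / f s := by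
    intro u
    obtain ⟨x, s, rfl⟩ := IsLocalization.exists_mk'_eq Q.primeCompl u
    have hs : f s ≠ 0 := (map_ne_zero_iff f hf).2
      (nonZeroDivisors.ne_zero (Q.primeCompl_le_nonZeroDivisors s.2))
    refine ⟨x, s, hs, ?_⟩
    rw [eq_div_iff hs]
    change algebraMap S F _ * algebraMap S F (algebraMap T S _) = algebraMap S F (algebraMap T S _)
    rw [← map_mul, IsLocalization.mk'_spec]
  have : FaithfulSMul R F := (faithfulSMul_iff_algebraMap_injective R F).2
    ((IsFractionRing.injective S F).comp Subtype.val_injective)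
  refine IsFractionRing.of_field R F fun z ↦ ?_
  have : ∃ x y : T, z = f x / f y := by
    obtain ⟨u, v, -, rfl⟩ := IsFractionRing.div_surjective (A := S) z
    obtain ⟨x, s, hs, hu⟩ := hS u
    obtain ⟨y, t, ht, hv⟩ := hS v
    refine ⟨x * t, s * y, ?_⟩
    rw [hu, hv, map_mul, map_mul, div_div_div_eq]
  obtain ⟨x, y, rfl⟩ := this
  obtain ⟨a, b, hb, hab⟩ := hT x
  obtain ⟨c, d, hd, hcd⟩ := hT y
  refine ⟨⟨_, hR (a * d)⟩, ⟨_, hR (b * c)⟩, ?_⟩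
  change _ = f (algebraMap D T (a * d)) / f (algebraMap D T (b * c))
  have hb' := (map_ne_zero_iff f hf).2 hb
  have hd' := (map_ne_zero_iff f hf).2 hd
  rw [map_mul, map_mul, map_mul, map_mul, ← hab, ← hcd, map_mul, map_mul]
  by_cases hy : f y = 0
  · simp [hy]
  field_simp

variable {K : Type*} [Field K]

theorem mul_mem_nonunits {V : ValuationSubring K} {x y : K} (hx : x ∈ V) (hy : y ∈ V.nonunits) :
    x * y ∈ V.nonunits := by
  rw [ValuationSubring.mem_nonunits_iff] at hy ⊢
  rw [map_mul]
  exact (mul_le_of_le_one_left' ((V.valuation_le_one_iff x).2 hx)).trans_lt hy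

theorem one_notMem_nonunits (V : ValuationSubring K) : (1 : K) ∉ V.nonunits := by
  simp [ValuationSubring.mem_nonunits_iff]

theorem exists_le_of_center_le {A : Type*} [CommRing A] (φ : A →+* K) (V : ValuationSubring K)
    (hV : ∀ a, φ a ∈ V) (p : Ideal A) [hp : p.IsPrime] (hVp : ∀ a, φ a ∈ V.nonunits → a ∈ p) :
    ∃ W ≤ V, (∀ a, φ a ∈ W) ∧ ∀ a, φ a ∈ W.nonunits ↔ a ∈ p := by
  let B : Subring K :=
    { carrier := {x | ∃ a, x - φ a ∈ V.nonunits}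
      mul_mem' := by
        rintro x y ⟨a, ha⟩ ⟨b, hb⟩
        refine ⟨a * b, ?_⟩
        have hy : y ∈ V := by
          simpa using add_mem (ValuationSubring.nonunits_subset hb) (hV b)
        have : x * y - φ (a * b) = y * (x - φ a) + φ a * (y - φ b) := by
          rw [map_mul]; ring
        rw [this]
        exact add_mem (mul_mem_nonunits hy ha) (mul_mem_nonunits (hV a) hb)
      one_mem' := ⟨1, by simp⟩
      zero_mem' := ⟨0, by simp⟩
      add_mem' := by
        rintro x y ⟨a, ha⟩ ⟨b, hb⟩
        refine ⟨a + b, ?_⟩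
        simpa [add_sub_add_comm] using add_mem ha hb
      neg_mem' := by
        rintro x ⟨a, ha⟩
        refine ⟨-a, ?_⟩
        simpa [neg_add_eq_sub] using neg_mem ha }
  have hBV : ∀ x ∈ B, x ∈ V := by
    rintro x ⟨a, ha⟩
    simpa using add_mem (ValuationSubring.nonunits_subset ha) (hV a)
  have key : ∀ (x : K) (a b : A), x - φ a ∈ V.nonunits → x - φ b ∈ V.nonunits → b ∈ p → a ∈ p := by
    intro x a b ha hb hbp
    have : a - b ∈ p := hVp _ (by simpa using sub_mem hb ha)
    simpa using add_mem this hbp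
  let I : Ideal B :=
    { carrier := {x | ∃ a ∈ p, (x : K) - φ a ∈ V.nonunits}
      zero_mem' := ⟨0, zero_mem p, by simp⟩
      add_mem' := by
        rintro x y ⟨a, hap, ha⟩ ⟨b, hbp, hb⟩
        refine ⟨a + b, add_mem hap hbp, ?_⟩
        simpa [add_sub_add_comm] using add_mem ha hb
      smul_mem' := by
        rintro ⟨x, c, hc⟩ ⟨y, hy⟩ ⟨a, hap, ha⟩
        refine ⟨c * a, p.mul_mem_left _ hap, ?_⟩
        have : x * y - φ (c * a) = y * (x - φ c) + φ c * (y - φ a) := by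
          rw [map_mul]; ring
        change x * y - φ (c * a) ∈ _
        rw [this]
        exact add_mem (mul_mem_nonunits (hBV y hy) hc) (mul_mem_nonunits (hV c) ha) }
  have hI : ∀ (x : B) (a : A), (x : K) - φ a ∈ V.nonunits → (x ∈ I ↔ a ∈ p) := fun x a ha ↦
    ⟨fun ⟨b, hbp, hb⟩ ↦ key x a b ha hb hbp, fun hap ↦ ⟨a, hap, ha⟩⟩
  have hIprime : I.IsPrime := by
    refine ⟨fun h ↦ hp.ne_top ?_, ?_⟩
    · rw [Ideal.eq_top_iff_one] at h ⊢
      exact (hI 1 1 (by simp)).1 h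
    · rintro x y hxy
      obtain ⟨a, ha⟩ := x.2
      obtain ⟨b, hb⟩ := y.2
      have : ((x * y : B) : K) - φ (a * b) ∈ V.nonunits := by
        have : (x * y : K) - φ (a * b) = y * (x - φ a) + φ a * (y - φ b) := by
          rw [map_mul]; ring
        rw [Subring.coe_mul, this]
        exact add_mem (mul_mem_nonunits (hBV y y.2) ha) (mul_mem_nonunits (hV a) hb)
      rw [hI _ _ this] at hxy
      rw [hI x a ha, hI y b hb]
      exact hp.mem_or_mem hxy
  have hunit : ∀ y : I.primeCompl, IsUnit (B.subtype y) := by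
    rintro ⟨y, hy⟩
    rw [isUnit_iff_ne_zero]
    rintro h
    exact hy ((Subtype.ext h : y = 0) ▸ zero_mem I)
  let ψ : Localization.AtPrime I →+* K := IsLocalization.lift hunit
  have hψ : ∀ b : B, ψ (algebraMap _ _ b) = b := fun b ↦ IsLocalization.lift_eq hunit b
  obtain ⟨W, hW, hloc⟩ := IsLocalRing.exists_factor_valuationRing ψ
  have hBW : ∀ b : B, (b : K) ∈ W := fun b ↦ hψ b ▸ hW _
  have hcent : ∀ b : B, (b : K) ∈ W.nonunits ↔ b ∈ I := by
    intro b
    rw [← IsLocalization.AtPrime.to_map_mem_maximal_iff (Localization.AtPrime I) I b,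
      IsLocalRing.mem_maximalIdeal, ValuationSubring.mem_nonunits_iff_exists_mem_maximalIdeal]
    simp only [IsLocalRing.mem_maximalIdeal, mem_nonunits_iff]
    rw [← isUnit_map_iff (ψ.codRestrict W.toSubring hW)]
    constructor
    · rintro ⟨h1, h2⟩ h3
      apply h2
      have : ψ.codRestrict W.toSubring hW (algebraMap _ _ b) = ⟨b, h1⟩ := Subtype.ext (hψ b)
      exact this ▸ h3
    · refine fun h ↦ ⟨hBW b, fun h3 ↦ h ?_⟩
      have : ψ.codRestrict W.toSubring hW (algebraMap _ _ b) = ⟨b, hBW b⟩ := Subtype.ext (hψ b)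
      exact this ▸ h3

  have hφB : ∀ a, φ a ∈ B := fun a ↦ ⟨a, by simp⟩
  refine ⟨W, ?_, fun a ↦ hBW ⟨_, hφB a⟩, fun a ↦ ?_⟩
  · rw [← ValuationSubring.nonunits_le_nonunits]
    intro x hx
    have hxB : x ∈ B := ⟨0, by simpa using hx⟩
    exact (hcent ⟨x, hxB⟩).2 ⟨0, zero_mem p, by simpa using hx⟩
  · exact (hcent ⟨_, hφB a⟩).trans (hI _ a (by simp))

theorem exists_ltSeries_of_primeSpectrum {A : Type*} [CommRing A] (φ : A →+* K)
    (V : ValuationSubring K) (hV : ∀ a, φ a ∈ V) (p : LTSeries (PrimeSpectrum A))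
    (hVp : ∀ a, φ a ∈ V.nonunits → a ∈ p.head.asIdeal) :
    ∃ c : LTSeries (ValuationSubring K), c.length = p.length ∧ c.last ≤ V ∧
      (∀ a, φ a ∈ c.head) ∧ ∀ a, φ a ∈ c.head.nonunits ↔ a ∈ p.last.asIdeal := by
  induction p using RelSeries.inductionOn' with
  | singleton x =>
    obtain ⟨W, hWV, hW, h⟩ := exists_le_of_center_le φ V hV x.asIdeal hVp
    exact ⟨RelSeries.singleton _ W, rfl, hWV, hW, h⟩
  | snoc p x hx ih =>
    rw [RelSeries.head_snoc] at hVp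
    obtain ⟨c, hcl, hcV, hc, h⟩ := ih hVp
    have hlt : p.last < x := hx
    obtain ⟨W, hWV, hW, hWx⟩ := exists_le_of_center_le φ c.head hc x.asIdeal
      fun a ha ↦ hlt.le ((h a).1 ha)
    have hW' : W < c.head := by
      refine lt_of_le_of_ne hWV ?_
      rintro rfl
      exact hlt.ne (PrimeSpectrum.ext (Ideal.ext fun a ↦ (h a).symm.trans (hWx a)))
    refine ⟨c.cons W hW', ?_, ?_, ?_, ?_⟩
    · rw [RelSeries.cons_length, hcl, RelSeries.snoc_length]
    · simpa using hcV
    · simpa using hW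
    · simpa using hWx

theorem _root_.AlgebraicIndependent.option_elim_of_map_eq_zero {k B C ι : Type*} [Field k]
    [CommRing B]
    [IsDomain B] [CommRing C] [Algebra k B] [Algebra k C] (π : B →ₐ[k] C) {x : ι → B}
    (hx : AlgebraicIndependent k (π ∘ x)) {a : B} (ha : a ≠ 0) (hπa : π a = 0) :
    AlgebraicIndependent k (fun o : Option ι ↦ o.elim a x) := by
  have hx' := hx.of_comp π
  rw [hx'.option_iff_transcendental, transcendental_iff]
  have hinj : ∀ y ∈ Algebra.adjoin k (Set.range x), π y = 0 → y = 0 := by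
    intro y hy h
    rw [Algebra.adjoin_range_eq_range_aeval] at hy
    obtain ⟨P, rfl⟩ := hy
    have : MvPolynomial.aeval (π ∘ x) P = 0 := by
      rw [← h]
      exact (MvPolynomial.comp_aeval_apply x π P).symm
    rw [(algebraicIndependent_iff.1 hx) P this, map_zero]
  intro P hP
  by_contra hP0
  obtain ⟨Q, hQ, hnd⟩ := Polynomial.exists_eq_pow_rootMultiplicity_mul_and_not_dvd P hP0 0
  rw [hQ] at hP
  simp only [map_zero, sub_zero, map_mul, map_pow, Polynomial.aeval_X, mul_eq_zero,
    pow_eq_zero_iff', ha, false_and, false_or] at hP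
  rw [map_zero, sub_zero, Polynomial.X_dvd_iff] at hnd
  apply hnd
  have h1 : π (Q.coeff 0 : B) = 0 := by
    have h2 := congrArg (Polynomial.aeval a) (Polynomial.X_mul_divX_add Q)
    rw [hP, map_add, map_mul, Polynomial.aeval_X, Polynomial.aeval_C] at h2
    have h3 := congrArg π h2
    rw [map_add, map_mul, hπa, zero_mul, zero_add, map_zero] at h3
    exact h3
  exact Subtype.ext (hinj _ (Q.coeff 0).2 h1)

theorem exists_algebraicIndependent_of_ltSeries {k A : Type*} [Field k] [CommRing A] [Algebra k A]
    (p : LTSeries (PrimeSpectrum A)) :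
    ∃ (ι : Type) (x : ι → A), Finite ι ∧ Nat.card ι = p.length ∧
      AlgebraicIndependent k (Ideal.Quotient.mkₐ k p.head.asIdeal ∘ x) := by
  induction p using RelSeries.inductionOn with
  | singleton P =>
    have := P.2
    refine ⟨Empty, Empty.elim, inferInstance, by simp, ?_⟩
    rw [algebraicIndependent_empty_type_iff]
    exact FaithfulSMul.algebraMap_injective _ _
  | cons p P hP ih =>
    obtain ⟨ι, x, hfin, hcard, hx⟩ := ih
    have hlt : P < p.head := hP
    have hlt' : P.asIdeal < p.head.asIdeal := hlt
    obtain ⟨a, ha, haP⟩ := Set.exists_of_ssubset hlt'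
    have := P.2
    refine ⟨Option ι, fun o ↦ o.elim a x, inferInstance, ?_, ?_⟩
    · rw [Finite.card_option, hcard, RelSeries.cons_length]
    · let π : (A ⧸ P.asIdeal) →ₐ[k] (A ⧸ p.head.asIdeal) :=
        Ideal.Quotient.factorₐ k hlt'.le
      have h := AlgebraicIndependent.option_elim_of_map_eq_zero π
        (x := Ideal.Quotient.mkₐ k P.asIdeal ∘ x) (a := Ideal.Quotient.mkₐ k P.asIdeal a) hx
        (fun h ↦ haP (Ideal.Quotient.eq_zero_iff_mem.1 h)) (Ideal.Quotient.eq_zero_iff_mem.2 ha)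
      rw [RelSeries.head_cons]
      convert h using 1
      funext o
      cases o <;> rfl

theorem length_le_trdeg {k F : Type u} [Field k] [Field F] [Algebra k F]
    (p : LTSeries (ValuationSubring F)) (hp : ∀ a : k, algebraMap k F a ∈ p.head) :
    (p.length : Cardinal) ≤ Algebra.trdeg k F := by
  let _ : Algebra k p.head := ((algebraMap k F).codRestrict p.head.toSubring hp).toAlgebra
  let e := (ValuationSubring.primeSpectrumOrderEquiv p.head).symm
  let q : LTSeries (PrimeSpectrum p.head) := LTSeries.mk p.length
    (fun i ↦ OrderDual.ofDual (e ⟨p i.rev, LTSeries.head_le p _⟩)) (by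
      intro i j hij
      apply OrderDual.ofDual_lt_ofDual.2
      rw [e.lt_iff_lt]
      exact p.strictMono (Fin.rev_lt_rev.2 hij))
  obtain ⟨ι, x, hfin, hcard, hx⟩ := exists_algebraicIndependent_of_ltSeries (k := k) q
  let f : p.head →ₐ[k] F := { p.head.subtype with commutes' := fun _ ↦ rfl }
  have h := ((hx.of_comp _).map' (f := f) Subtype.val_injective).lift_cardinalMk_le_trdeg
  have := Fintype.ofFinite ι
  rw [Cardinal.mk_fintype, ← Nat.card_eq_fintype_card, hcard] at h
  rw [Cardinal.lift_natCast, Cardinal.lift_uzero] at h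
  exact h

theorem exists_algebraicIndependent_fin {k F : Type u} [Field k] [Field F] [Algebra k F] {n : ℕ}
    (hn : (n : Cardinal) ≤ Algebra.trdeg k F) : ∃ x : Fin n → F, AlgebraicIndependent k x := by
  obtain ⟨ι, x, hx⟩ := exists_isTranscendenceBasis' k F
  rw [← hx.cardinalMk_eq_trdeg, ← Cardinal.lift_natCast.{u, 0}, ← Cardinal.mk_fin,
    ← Cardinal.lift_uzero (Cardinal.mk ι), Cardinal.lift_mk_le'] at hn
  obtain ⟨g⟩ := hn
  exact ⟨x ∘ g, hx.1.comp g g.injective⟩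

theorem exists_ltSeries_of_algebraicIndependent {C E k K : Type*} [CommRing C] [CommRing E]
    [Field k] [Algebra k E] [Field K] (φ : C →+* K) (V : ValuationSubring K) (hV : ∀ c, φ c ∈ V)
    (π : C →+* E) (hπ : Function.Surjective π) (hVπ : ∀ c, φ c ∈ V.nonunits → π c = 0) {n : ℕ}
    {x : Fin n → E} (hx : AlgebraicIndependent k x) :
    ∃ c : LTSeries (ValuationSubring K), c.length = n ∧ c.last ≤ V ∧
      ∀ a, π a ∈ (algebraMap k E).range → φ a ∈ c.head := by
  let A : Subring C := (Algebra.adjoin k (Set.range x)).toSubring.comap π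
  let ρ : A →+* Algebra.adjoin k (Set.range x) := (π.comp A.subtype).codRestrict _ fun a ↦ a.2
  let g : A →+* MvPolynomial (Fin n) k := (hx.aevalEquiv.symm : _ →+* _).comp ρ
  have hg : Function.Surjective g := by
    refine hx.aevalEquiv.symm.surjective.comp ?_
    rintro ⟨y, hy⟩
    obtain ⟨c, rfl⟩ := hπ y
    exact ⟨⟨c, hy⟩, rfl⟩
  have hdim : ((n : ℕ) : WithBot ℕ∞) ≤ Order.krullDim (PrimeSpectrum (MvPolynomial (Fin n) k)) := by
    have := MvPolynomial.ringKrullDim_of_isNoetherianRing (R := k) (ι := Fin n)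
    rw [ringKrullDim_eq_zero_of_field, zero_add, Nat.card_fin] at this
    exact this.ge
  obtain ⟨p, hp⟩ := Order.le_krullDim_iff.1 hdim
  let q : LTSeries (PrimeSpectrum A) := p.map (PrimeSpectrum.comap g) (by
    refine Monotone.strictMono_of_injective (fun P Q h ↦ Ideal.comap_mono h)
      (PrimeSpectrum.comap_injective_of_surjective g hg))
  obtain ⟨c, hc, hcV, hcA, -⟩ := exists_ltSeries_of_primeSpectrum (φ.comp A.subtype) V
    (fun a ↦ hV a) q (by
      intro a ha
      change g a ∈ p.head.asIdeal
      have : ρ a = 0 := Subtype.ext (hVπ a ha)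
      have : g a = 0 := by
        change hx.aevalEquiv.symm (ρ a) = 0
        rw [this, map_zero]
      rw [this]
      exact zero_mem _)
  refine ⟨c, hc.trans hp, hcV, ?_⟩
  rintro a ⟨b, hb⟩
  exact hcA ⟨a, show π a ∈ Algebra.adjoin k (Set.range x) from hb ▸ Subalgebra.algebraMap_mem _ b⟩

/-- The image in the residue field of `V` of a valuation subring contained in `V`. -/
def residueImage {K : Type*} [Field K] (V W : ValuationSubring K) (h : W ≤ V) :
    ValuationSubring (IsLocalRing.ResidueField V) :=
  { (W.toSubring.comap V.subtype).map (IsLocalRing.residue V) with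
    mem_or_inv_mem' := by
      intro z
      obtain ⟨v, rfl⟩ := IsLocalRing.residue_surjective z
      by_cases hz : IsLocalRing.residue V v = 0
      · left
        rw [hz]
        exact zero_mem ((W.toSubring.comap V.subtype).map (IsLocalRing.residue V))
      rcases W.mem_or_inv_mem v with hv | hv
      · exact Or.inl ⟨v, hv, rfl⟩
      · refine Or.inr ⟨⟨(v : K)⁻¹, h hv⟩, hv, ?_⟩
        refine eq_inv_of_mul_eq_one_left ?_
        rw [← map_mul, ← map_one (IsLocalRing.residue V)]
        congr 1
        refine Subtype.ext (inv_mul_cancel₀ ?_)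
        rintro h0
        exact hz (by rw [show v = 0 from Subtype.ext h0, map_zero]) }

theorem residue_mem_residueImage {V W : ValuationSubring K} (h : W ≤ V) {v : V} :
    IsLocalRing.residue V v ∈ residueImage V W h ↔ (v : K) ∈ W := by
  constructor
  · rintro ⟨w, hw, hvw⟩
    have h1 : v - w ∈ IsLocalRing.maximalIdeal V := Ideal.Quotient.eq.1 hvw.symm
    have h2 : ((v - w : V) : K) ∈ W := ValuationSubring.nonunits_subset
      (ValuationSubring.nonunits_le_nonunits.2 h (ValuationSubring.coe_mem_nonunits_iff.2 h1))
    have h3 : (v : K) - w ∈ W := h2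
    simpa using add_mem h3 hw
  · exact fun hv ↦ ⟨v, hv, rfl⟩

theorem residueImage_lt {V W W' : ValuationSubring K} (hW' : W' ≤ V) (h : W < W') :
    residueImage V W (h.le.trans hW') < residueImage V W' hW' := by
  obtain ⟨x, hx, hxW⟩ := Set.exists_of_ssubset (show (W : Set K) ⊂ W' from h)
  refine lt_of_le_of_ne ?_ fun heq ↦ ?_
  · intro z hz
    obtain ⟨v, rfl⟩ := IsLocalRing.residue_surjective z
    rw [residue_mem_residueImage] at hz ⊢
    exact h.le hz
  · have : IsLocalRing.residue V ⟨x, hW' hx⟩ ∈ residueImage V W' hW' :=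
      (residue_mem_residueImage _).2 hx
    rw [← heq, residue_mem_residueImage] at this
    exact hxW this

theorem length_le_trdeg_residueField {k K : Type u} [Field k] [Field K] {V : ValuationSubring K}
    [Algebra k (IsLocalRing.ResidueField V)] (p : LTSeries (ValuationSubring K))
    (hpV : p.last ≤ V)
    (hp : ∀ a : k, ∃ v : V, (v : K) ∈ p.head ∧ IsLocalRing.residue V v = algebraMap k _ a) :
    (p.length : Cardinal) ≤ Algebra.trdeg k (IsLocalRing.ResidueField V) := by
  have hle : ∀ i, p i ≤ V := fun i ↦ (p.monotone (Fin.le_last i)).trans hpV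
  refine length_le_trdeg (LTSeries.mk p.length (fun i ↦ residueImage V (p i) (hle i))
    fun i j hij ↦ residueImage_lt _ (p.strictMono hij)) fun a ↦ ?_
  obtain ⟨v, hv, hva⟩ := hp a
  rw [← hva]
  exact (residue_mem_residueImage (hle 0)).2 hv

theorem exists_least_overring {S : Type*} [CommRing S] [IsLocalRing S] (φ : S →+* K)
    (W : ValuationSubring K) (hW : ∀ s ∈ IsLocalRing.maximalIdeal S, φ s ∈ W.nonunits) :
    ∃ V : ValuationSubring K, W ≤ V ∧ (∀ s, φ s ∈ V) ∧
      (∀ V' : ValuationSubring K, W ≤ V' → (∀ s, φ s ∈ V') → V ≤ V') ∧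
      ∀ s ∈ IsLocalRing.maximalIdeal S, φ s ∈ V.nonunits := by
  let B : Subring K := W.toSubring ⊔ φ.range
  let Q : K → Prop := fun y ↦ ∀ m ∈ IsLocalRing.maximalIdeal S, φ m * y ∈ W.nonunits
  have hQ : ∀ x ∈ B, ∀ y, Q y → Q (x * y) := by
    intro x hx
    rw [show B = Subring.closure ((W.toSubring : Set K) ∪ φ.range) by
      rw [Subring.closure_union, Subring.closure_eq, Subring.closure_eq]] at hx
    induction hx using Subring.closure_induction with
    | mem x hx =>
      intro y hy m hm
      rcases hx with hx | ⟨s, rfl⟩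
      · rw [mul_left_comm]
        exact mul_mem_nonunits hx (hy m hm)
      · rw [← mul_assoc, ← map_mul]
        exact hy _ (Ideal.mul_mem_right _ _ hm)
    | zero => intro y hy m hm; simp
    | one => intro y hy; rwa [one_mul]
    | add x x' _ _ h h' =>
      intro y hy m hm
      rw [add_mul, mul_add]
      exact add_mem (h y hy m hm) (h' y hy m hm)
    | neg x _ h =>
      intro y hy m hm
      rw [neg_mul, mul_neg]
      exact neg_mem (h y hy m hm)
    | mul x x' _ _ h h' =>
      intro y hy
      rw [mul_assoc]
      exact h _ (h' _ hy)
  have hWB : W.toSubring ≤ B := le_sup_left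
  refine ⟨W.ofLE B hWB, hWB, fun s ↦ (le_sup_right : φ.range ≤ B) ⟨s, rfl⟩, ?_, ?_⟩
  · intro V' hWV' hV'
    have : B ≤ V'.toSubring := sup_le hWV' (by rintro _ ⟨s, rfl⟩; exact hV' s)
    exact this
  · intro s hs
    rw [ValuationSubring.mem_nonunits_iff_or]
    by_contra! h
    have h1 := hQ _ h.2 1 (by simpa [Q] using hW) s hs
    rw [mul_one, mul_inv_cancel₀ h.1] at h1
    exact one_notMem_nonunits _ h1

theorem exists_split_ltSeries {α : Type*} [PartialOrder α] (p : LTSeries α) (v : α)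
    (hv : p.head ≤ v) (hcomp : ∀ x ∈ p, x ≤ v ∨ v ≤ x) :
    ∃ a b : LTSeries α, a.last = v ∧ b.head = v ∧ p.head ≤ a.head ∧
      p.length ≤ a.length + b.length := by
  suffices h : p.last < v ∨ ∃ a b : LTSeries α, a.last = v ∧ b.head = v ∧ p.head ≤ a.head ∧
      p.length ≤ a.length + b.length ∧ b.last = p.last by
    rcases h with h | ⟨a, b, h1, h2, h3, h4, -⟩
    · exact ⟨p.snoc v h, RelSeries.singleton _ v, by simp, rfl, by simp, by simp⟩
    · exact ⟨a, b, h1, h2, h3, h4⟩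
  induction p using RelSeries.inductionOn' with
  | singleton x =>
    have hx : x ≤ v := hv
    rcases hx.lt_or_eq with h | rfl
    · exact Or.inl h
    · exact Or.inr ⟨RelSeries.singleton _ x, RelSeries.singleton _ x, rfl, rfl, le_rfl, by simp, rfl⟩
  | snoc p x hx ih =>
    have hx' : p.last < x := hx
    rw [RelSeries.head_snoc] at hv ⊢
    rw [RelSeries.last_snoc]
    have hcx : x ≤ v ∨ v ≤ x := hcomp x (RelSeries.mem_snoc.2 (Or.inr rfl))
    rcases ih hv (fun y hy ↦ hcomp y (RelSeries.mem_snoc.2 (Or.inl hy))) with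
      h | ⟨a, b, h1, h2, h3, h4, h5⟩
    · by_cases hxv : x < v
      · exact Or.inl hxv
      have hvx : v ≤ x := hcx.elim (fun h ↦ (eq_or_lt_of_le h).elim (fun h ↦ h.ge)
        fun h ↦ absurd h hxv) id
      refine Or.inr ?_
      rcases hvx.lt_or_eq with hlt | rfl
      · exact ⟨p.snoc v h, (RelSeries.singleton _ v).snoc x hlt, by simp,
          RelSeries.head_snoc .., by simp, by simp, RelSeries.last_snoc ..⟩
      · exact ⟨p.snoc v h, RelSeries.singleton _ v, by simp, by simp, by simp, by simp, rfl⟩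
    · refine Or.inr ⟨a, b.snoc x (h5 ▸ hx), h1, by simpa using h2, h3, ?_, by simp⟩
      simp only [RelSeries.snoc_length]
      omega

theorem exists_ltSeries_append {α : Type*} [PartialOrder α] (a b : LTSeries α)
    (h : a.last ≤ b.head) : ∃ c : LTSeries α, c.head = a.head ∧ a.length + b.length ≤ c.length := by
  rcases h.lt_or_eq with h | h
  · exact ⟨a.append b h, RelSeries.head_append .., by rw [RelSeries.append_length]; omega⟩
  · exact ⟨a.smash b h, RelSeries.head_smash .., le_rfl⟩

theorem exists_ltSeries_of_pullback {S K : Type u} [CommRing S] [IsLocalRing S] [Field K]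
    (φ : S →+* K) (k : Subfield (IsLocalRing.ResidueField S)) (p : LTSeries (ValuationSubring K))
    (hp : ∀ s, IsLocalRing.residue S s ∈ k → φ s ∈ p.head) {t : ℕ}
    (ht : Algebra.trdeg k (IsLocalRing.ResidueField S) = t) :
    ∃ c : LTSeries (ValuationSubring K), (∀ s, φ s ∈ c.head) ∧ p.length ≤ c.length + t := by
  by_cases hW : ∀ m ∈ IsLocalRing.maximalIdeal S, φ m ∈ p.head.nonunits
  · obtain ⟨V, hpV, hSV, hmin, hV⟩ := exists_least_overring φ p.head hW
    have hcomp : ∀ W ∈ p, W ≤ V ∨ V ≤ W := by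
      intro W hWp
      obtain ⟨i, rfl⟩ := RelSeries.mem_def.1 hWp
      exact le_total (⟨p i, p.head_le i⟩ : {W // p.head ≤ W}) ⟨V, hpV⟩
    obtain ⟨a, b, haV, hbV, hpa, hlen⟩ := exists_split_ltSeries p V hpV hcomp
    let ψ : S →+* V := φ.codRestrict V.toSubring hSV
    have hψ : IsLocalHom ψ := by
      refine ⟨fun s hs ↦ ?_⟩
      by_contra hns
      have h1 : ψ s ∈ IsLocalRing.maximalIdeal V :=
        ValuationSubring.coe_mem_nonunits_iff.1 (hV s hns)
      exact h1 hs
    let _ : Algebra (IsLocalRing.ResidueField S) (IsLocalRing.ResidueField V) :=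
      (IsLocalRing.ResidueField.map ψ).toAlgebra
    have h1 := length_le_trdeg_residueField (k := k) a haV.le (by
      intro x
      obtain ⟨s, hs⟩ := IsLocalRing.residue_surjective (x : IsLocalRing.ResidueField S)
      refine ⟨ψ s, hpa (hp s (hs ▸ x.2)), ?_⟩
      change _ = IsLocalRing.ResidueField.map ψ x
      rw [← hs, IsLocalRing.ResidueField.map_residue])
    rw [← trdeg_add_eq k (IsLocalRing.ResidueField S), ht] at h1
    have h2 : ((a.length - t : ℕ) : Cardinal) ≤
        Algebra.trdeg (IsLocalRing.ResidueField S) (IsLocalRing.ResidueField V) := by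
      by_contra! h
      obtain ⟨j, hj⟩ := Cardinal.lt_aleph0.1 (h.trans (Cardinal.natCast_lt_aleph0))
      rw [hj] at h h1
      norm_cast at h h1
      omega
    obtain ⟨y, hy⟩ := exists_algebraicIndependent_fin h2
    obtain ⟨c, hc, hcV, hcS⟩ := exists_ltSeries_of_algebraicIndependent V.subtype V (fun v ↦ v.2)
      (IsLocalRing.residue V) IsLocalRing.residue_surjective
      (fun v hv ↦ Ideal.Quotient.eq_zero_iff_mem.2 (ValuationSubring.coe_mem_nonunits_iff.1 hv)) hy
    obtain ⟨d, hd, hdl⟩ := exists_ltSeries_append c b (hcV.trans hbV.ge)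
    refine ⟨d, fun s ↦ ?_, by omega⟩
    rw [hd]
    exact hcS (ψ s) ⟨IsLocalRing.residue S s, IsLocalRing.ResidueField.map_residue ψ s⟩
  · push Not at hW
    obtain ⟨m, hm, hmW⟩ := hW
    refine ⟨p, fun s ↦ ?_, by omega⟩
    rw [ValuationSubring.mem_nonunits_iff_or, not_or, not_not] at hmW
    have h0 : ∀ s ∈ IsLocalRing.maximalIdeal S, φ s ∈ p.head := fun s hs ↦ by
      refine hp s ?_
      have h : IsLocalRing.residue S s = 0 := Ideal.Quotient.eq_zero_iff_mem.2 hs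
      rw [h]
      exact zero_mem k
    have : φ s = φ (s * m) * (φ m)⁻¹ := by
      rw [map_mul, mul_inv_cancel_right₀ hmW.1]
    rw [this]
    exact mul_mem (h0 _ (Ideal.mul_mem_left _ _ hm)) hmW.2

theorem le_krullDim_subtype_iff {α : Type*} [PartialOrder α] {P : α → Prop}
    (hP : ∀ x y, x ≤ y → P x → P y) {n : ℕ} :
    (n : WithBot ℕ∞) ≤ Order.krullDim {x // P x} ↔
      ∃ p : LTSeries α, P p.head ∧ n ≤ p.length := by
  constructor
  · intro h
    obtain ⟨p, hp⟩ := Order.le_krullDim_iff.1 h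
    exact ⟨p.map Subtype.val (fun _ _ h ↦ h), p.head.2, hp.ge⟩
  · rintro ⟨p, hp, hn⟩
    refine le_trans ?_ (Order.LTSeries.length_le_krullDim (LTSeries.mk p.length
      (fun i ↦ (⟨p i, hP _ _ (p.head_le i) hp⟩ : {x // P x})) fun i j h ↦ p.strictMono h))
    exact_mod_cast hn

theorem _root_.ENat.add_le_of_forall_natCast_le {a b c : ℕ∞}
    (h : ∀ m n : ℕ, (m : ℕ∞) ≤ a → (n : ℕ∞) ≤ b → ((m + n : ℕ) : ℕ∞) ≤ c) : a + b ≤ c := by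
  induction a using ENat.recTopCoe with
  | top =>
    refine le_top.trans (ENat.forall_natCast_le_iff_le.1 fun l _ ↦ ?_)
    simpa using h l 0 le_top (by simp)
  | coe a =>
    induction b using ENat.recTopCoe with
    | top =>
      refine le_top.trans (ENat.forall_natCast_le_iff_le.1 fun l _ ↦ ?_)
      simpa using h 0 l (by simp) le_top
    | coe b => exact_mod_cast h a b le_rfl le_rfl

theorem krullDim_pullback {S K : Type u} [CommRing S] [IsLocalRing S] [Field K]
    (φ : S →+* K) (k : Subfield (IsLocalRing.ResidueField S)) :
    Order.krullDim {V : ValuationSubring K // ∀ s, IsLocalRing.residue S s ∈ k → φ s ∈ V} =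
      Order.krullDim {V : ValuationSubring K // ∀ s, φ s ∈ V} +
        ((Cardinal.toENat (Algebra.trdeg k (IsLocalRing.ResidueField S)) : ℕ∞) : WithBot ℕ∞) := by
  have hS : ∀ V W : ValuationSubring K, V ≤ W → (∀ s, φ s ∈ V) → ∀ s, φ s ∈ W :=
    fun V W h hV s ↦ h (hV s)
  have hR : ∀ V W : ValuationSubring K, V ≤ W → (∀ s, IsLocalRing.residue S s ∈ k → φ s ∈ V) →
      ∀ s, IsLocalRing.residue S s ∈ k → φ s ∈ W := fun V W h hV s hs ↦ h (hV s hs)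
  have : Nonempty {V : ValuationSubring K // ∀ s, φ s ∈ V} := ⟨⊤, fun s ↦ trivial⟩
  obtain ⟨d, hd⟩ := WithBot.ne_bot_iff_exists.1 (Order.krullDim_ne_bot_iff.2 this)
  have : Nonempty {V : ValuationSubring K // ∀ s, IsLocalRing.residue S s ∈ k → φ s ∈ V} :=
    ⟨⊤, fun s _ ↦ trivial⟩
  obtain ⟨r, hr⟩ := WithBot.ne_bot_iff_exists.1 (Order.krullDim_ne_bot_iff.2 this)
  have hd' : ∀ n : ℕ, (n : ℕ∞) ≤ d ↔ ∃ p : LTSeries (ValuationSubring K),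
      (∀ s, φ s ∈ p.head) ∧ n ≤ p.length := fun n ↦ by
    rw [← le_krullDim_subtype_iff hS, ← hd]
    norm_cast
  have hr' : ∀ n : ℕ, (n : ℕ∞) ≤ r ↔ ∃ p : LTSeries (ValuationSubring K),
      (∀ s, IsLocalRing.residue S s ∈ k → φ s ∈ p.head) ∧ n ≤ p.length := fun n ↦ by
    rw [← le_krullDim_subtype_iff hR, ← hr]
    norm_cast
  rw [← hd, ← hr]
  norm_cast
  apply le_antisymm
  · by_cases ht : Algebra.trdeg k (IsLocalRing.ResidueField S) < Cardinal.aleph0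
    · obtain ⟨t, ht⟩ := Cardinal.lt_aleph0.1 ht
      rw [ht, Cardinal.toENat_nat]
      refine ENat.forall_natCast_le_iff_le.1 fun n hn ↦ ?_
      obtain ⟨p, hp, hnp⟩ := (hr' n).1 hn
      obtain ⟨c, hc, hpc⟩ := exists_ltSeries_of_pullback φ k p hp ht
      calc (n : ℕ∞) ≤ ((c.length + t : ℕ) : ℕ∞) := by exact_mod_cast hnp.trans hpc
        _ = c.length + t := by push_cast; rfl
        _ ≤ d + t := by gcongr; exact (hd' _).2 ⟨c, hc, le_rfl⟩
    · rw [Cardinal.toENat_eq_top.2 (not_lt.1 ht)]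
      simp
  · refine ENat.add_le_of_forall_natCast_le fun m n hm hn ↦ ?_
    obtain ⟨p, hp, hmp⟩ := (hd' m).1 hm
    obtain ⟨x, hx⟩ := exists_algebraicIndependent_fin (Cardinal.natCast_le_toENat.1 hn)
    obtain ⟨c, hcl, hcp, hc⟩ := exists_ltSeries_of_algebraicIndependent φ p.head hp
      (IsLocalRing.residue S) IsLocalRing.residue_surjective
      (fun s hs ↦ Ideal.Quotient.eq_zero_iff_mem.2 fun hu ↦ by
        have h1 : IsUnit (φ.codRestrict p.head.toSubring hp s) := hu.map _
        exact (ValuationSubring.coe_mem_nonunits_iff (a := (⟨φ s, hp s⟩ : p.head))).1 hs h1) hx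
    obtain ⟨q, hq, hql⟩ := exists_ltSeries_append c p hcp
    refine (hr' _).2 ⟨q, fun s hs ↦ ?_, by omega⟩
    rw [hq]
    exact hc s ⟨⟨_, hs⟩, rfl⟩

theorem valuativeDim_pullback {D : Type*} {S : Type u} (F : Type u) [CommRing D] [IsDomain D]
    {T : Subalgebra D (FractionRing D)} (Q : Ideal T) [Q.IsPrime] [CommRing S] [IsDomain S]
    [IsLocalRing S] [Algebra T S] [IsLocalization.AtPrime S Q]
    [Field F] [Algebra S F] [IsFractionRing S F] (k : Subfield (IsLocalRing.ResidueField S))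
    (hk : ∀ d : D, IsLocalRing.residue S (algebraMap T S (algebraMap D T d)) ∈ k) :
    valuativeDim (k.toSubring.comap (IsLocalRing.residue S)) = valuativeDim S +
      ((Cardinal.toENat (trdeg k (IsLocalRing.ResidueField S)) : ℕ∞) : WithBot ℕ∞) := by
  have := isFractionRing_subring (F := F) Q (k.toSubring.comap (IsLocalRing.residue S)) hk
  rw [valuativeDim_eq_krullDim (k.toSubring.comap (IsLocalRing.residue S)) F,
    valuativeDim_eq_krullDim S F]
  refine Eq.trans ?_ (krullDim_pullback (algebraMap S F) k)
  exact congrArg (fun P : ValuationSubring F → Prop ↦ Order.krullDim {V // P V})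
    (funext fun V ↦ propext ⟨fun h s hs ↦ h ⟨s, hs⟩, fun h r ↦ h r.1 r.2⟩)

theorem valuativeDim_pullback_residue {D : Type*} {S : Type u} [CommRing D] [IsDomain D]
    {T : Subalgebra D (FractionRing D)} (Q : Ideal T) [Q.IsPrime] [CommRing S] [IsDomain S]
    [IsLocalRing S] [Algebra T S] [IsLocalization.AtPrime S Q]
    (k : Subfield (IsLocalRing.ResidueField S))
    (hk : ∀ d : D, IsLocalRing.residue S (algebraMap T S (algebraMap D T d)) ∈ k) :
    valuativeDim (k.toSubring.comap (IsLocalRing.residue S)) = valuativeDim S +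
      ((Cardinal.toENat (trdeg k (IsLocalRing.ResidueField S)) : ℕ∞) : WithBot ℕ∞) :=
  valuativeDim_pullback (FractionRing S) Q k hk

end ValuativeDim

/-- For the pullback `D(Q) = D_q + QT_Q`, the valuative dimension satisfies
`dim_v D(Q) = dim_v T_Q + trdeg_{k(q)} k(Q)`. -/
theorem statement_7 (D : Type*) [CommRing D] [IsDomain D]
    (T : Subalgebra D (FractionRing D)) (Q : Ideal T) [Q.IsPrime] :
    valuativeDim (DQ D T Q) = valuativeDim (Localization.AtPrime Q) +
      ((Cardinal.toENat (trdeg (kqSub D T Q)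
        (IsLocalRing.ResidueField (Localization.AtPrime Q))) : ℕ∞) : WithBot ℕ∞) := by
  exact ValuativeDim.valuativeDim_pullback_residue Q (kqSub D T Q)
    fun d ↦ Subfield.subset_closure ⟨d, rfl⟩
end

section
/- Let D ⊆ T be domains with T an overring of D, Q a prime of T and q = Q ∩ D. If the pullback domain D(Q) = D_q + QT_Q satisfies dim(D(Q)) = dim_v(D(Q)) < ∞ (i.e., D(Q) is a Jaffard domain) and dim_v(T_Q) < ∞, then the residue field k(Q) is algebraic over k(q). -/
set_option synthInstance.maxHeartbeats 1000000
set_option maxHeartbeats 1000000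

open Polynomial

/-- Every prime of a subring of a field is the center of some valuation subring. -/
theorem Subring.exists_valuationSubring_center_eq {K : Type*} [Field K] (B : Subring K)
    (P : Ideal B) [P.IsPrime] :
    ∃ V : ValuationSubring K, B ≤ V.toSubring ∧ ∀ b : B, b ∈ P ↔ (b : K) ∈ V.nonunits := by
  obtain ⟨V, hle, hloc⟩ := (LocalSubring.ofPrime B P).exists_le_valuationSubring
  have hBV : B ≤ V.toSubring := (LocalSubring.le_ofPrime B P).trans hle
  refine ⟨V, hBV, fun b => ?_⟩
  have h1 := IsLocalization.AtPrime.isUnit_to_map_iff (LocalSubring.ofPrime B P).toSubring P b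
  have h2 : IsUnit (Subring.inclusion hle (algebraMap B _ b)) ↔
      IsUnit (algebraMap B (LocalSubring.ofPrime B P).toSubring b) :=
    ⟨fun h => hloc.map_nonunit _ h, fun h => h.map _⟩
  have h3 : (b : K) ∈ V.nonunits ↔ ¬ IsUnit (Subring.inclusion hle (algebraMap B _ b)) := by
    rw [show (b : K) = ((⟨b, hBV b.2⟩ : V) : K) from rfl, ValuationSubring.coe_mem_nonunits_iff,
      IsLocalRing.mem_maximalIdeal, mem_nonunits_iff]
    rfl
  rw [h3, h2, h1]
  simp [Ideal.primeCompl]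

/-- A valuation subring whose center lies below a prime `P` can be shrunk to one centered
on `P`. -/
theorem ValuationSubring.exists_le_center_eq {A K : Type*} [CommRing A] [Field K] (f : A →+* K)
    (V : ValuationSubring K) (hV : ∀ a, f a ∈ V) (P : Ideal A) [P.IsPrime]
    (hP : ∀ a, f a ∈ V.nonunits → a ∈ P) :
    ∃ W ≤ V, (∀ a, f a ∈ W) ∧ ∀ a, a ∈ P ↔ f a ∈ W.nonunits := by
  let f' : A →+* V := f.codRestrict V.toSubring hV
  let g : A →+* IsLocalRing.ResidueField V := (IsLocalRing.residue V).comp f'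
  have hg : RingHom.ker g.rangeRestrict ≤ P := by
    intro a ha
    have : g a = 0 := congrArg Subtype.val ((RingHom.mem_ker).1 ha)
    refine hP a ?_
    rw [show f a = ((f' a : V) : K) from rfl, ValuationSubring.coe_mem_nonunits_iff]
    exact (IsLocalRing.residue_eq_zero_iff _).1 this
  let C : Subring V := g.range.comap (IsLocalRing.residue V)
  let ρ : C →+* g.range :=
    ((IsLocalRing.residue V).comp C.subtype).codRestrict g.range fun c => c.2
  let 𝔮 : Ideal g.range := P.map g.rangeRestrict
  have h𝔮 : 𝔮.IsPrime := Ideal.map_isPrime_of_surjective g.rangeRestrict_surjective hg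
  let B : Subring K := C.map V.subtype
  let e : C ≃+* B := C.equivMapOfInjective V.subtype Subtype.val_injective
  let 𝔭 : Ideal B := 𝔮.comap (ρ.comp (e.symm : B →+* C))
  have h𝔭 : 𝔭.IsPrime := Ideal.comap_isPrime _ _
  have hmem : ∀ c : C, e c ∈ 𝔭 ↔ ρ c ∈ 𝔮 := fun c => by
    simp [𝔭, Ideal.mem_comap]
  obtain ⟨W, hBW, hW⟩ := B.exists_valuationSubring_center_eq 𝔭
  have hmV : ∀ x ∈ V.nonunits, x ∈ W.nonunits := by
    intro x hx
    obtain ⟨hxV, hx⟩ := V.mem_nonunits_iff_exists_mem_maximalIdeal.1 hx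
    have h0 : IsLocalRing.residue V ⟨x, hxV⟩ = 0 := (IsLocalRing.residue_eq_zero_iff _).2 hx
    let c : C := ⟨⟨x, hxV⟩, by
      rw [Subring.mem_comap, h0]; exact g.range.zero_mem⟩
    refine (hW (e c)).1 ((hmem c).2 ?_)
    have : ρ c = 0 := Subtype.ext h0
    rw [this]; exact 𝔮.zero_mem
  have hc : ∀ a, f' a ∈ C := fun a => ⟨a, rfl⟩
  refine ⟨W, fun y hy => ?_, fun a => ?_, fun a => ?_⟩
  · by_contra hyV
    have h1 := hmV _ (V.inv_mem_nonunits_iff.2 (Or.inr hyV))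
    rcases W.inv_mem_nonunits_iff.1 h1 with h | h
    · exact hyV (h ▸ zero_mem V)
    · exact h hy
  · exact hBW (e ⟨f' a, hc a⟩).2
  · have h1 := hW (e ⟨f' a, hc a⟩)
    rw [hmem] at h1
    have h2 : ρ ⟨f' a, hc a⟩ = g.rangeRestrict a := rfl
    rw [h2] at h1
    refine Iff.trans ?_ h1
    have h3 : 𝔮.comap g.rangeRestrict = P := by
      rw [Ideal.comap_map_of_surjective _ g.rangeRestrict_surjective]
      exact sup_eq_left.2 hg
    rw [← Ideal.mem_comap, h3]

/-- A chain of primes whose least member contains the kernel of `f : A →+* K` lifts to a chain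
of valuation subrings of `K`. -/
theorem exists_ltSeries_valuationSubring {A K : Type*} [CommRing A] [Field K] (f : A →+* K)
    (p : LTSeries (PrimeSpectrum A)) :
    RingHom.ker f ≤ p.head.asIdeal →
    ∃ q : LTSeries (ValuationSubring K)ᵒᵈ, q.length = p.length ∧
      (∀ a, f a ∈ OrderDual.ofDual q.last) ∧
      ∀ a, a ∈ p.last.asIdeal ↔ f a ∈ (OrderDual.ofDual q.last).nonunits := by
  induction p using RelSeries.inductionOn' with
  | singleton x =>
    intro h
    obtain ⟨W, -, h1, h2⟩ := ValuationSubring.exists_le_center_eq f ⊤ (fun _ => trivial) x.asIdeal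
      (fun a ha => h (by
        rw [ValuationSubring.mem_nonunits_iff_or] at ha
        exact ha.resolve_right fun h => h trivial))
    exact ⟨RelSeries.singleton _ (OrderDual.toDual W), rfl, h1, h2⟩
  | snoc p x hx ih =>
    intro h
    rw [RelSeries.head_snoc] at h
    obtain ⟨q, hq, hq1, hq2⟩ := ih h
    have hlt : p.last < x := hx
    obtain ⟨W, hWV, h1, h2⟩ := ValuationSubring.exists_le_center_eq f (OrderDual.ofDual q.last)
      hq1 x.asIdeal (fun a ha => hlt.le ((hq2 a).2 ha))
    have hne : W ≠ OrderDual.ofDual q.last := by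
      rintro rfl
      refine hlt.ne (PrimeSpectrum.ext (Ideal.ext fun a => ?_))
      rw [h2, hq2]
    have hqW : q.last < OrderDual.toDual W := lt_of_le_of_ne hWV fun h => hne h.symm
    refine ⟨q.snoc (OrderDual.toDual W) hqW, ?_, ?_, ?_⟩
    · simp [hq]
    · simpa using h1
    · simpa using h2

theorem ValuationSubring.length_le_ringKrullDim {K : Type*} [Field K]
    (q : LTSeries (ValuationSubring K)ᵒᵈ) :
    (q.length : WithBot ℕ∞) ≤ ringKrullDim (OrderDual.ofDual q.last : ValuationSubring K) := by
  let V : ValuationSubring K := OrderDual.ofDual q.last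
  have hle : ∀ i, V ≤ OrderDual.ofDual (q i) := fun i => q.monotone (Fin.le_last i)
  let r : LTSeries (PrimeSpectrum V) :=
    { length := q.length
      toFun := fun i => OrderDual.ofDual (V.primeSpectrumOrderEquiv.symm ⟨_, hle i⟩)
      step := fun i => by
        have : q i.castSucc < q i.succ := q.step i
        have h2 : (⟨_, hle i.succ⟩ : {S // V ≤ S}) < ⟨_, hle i.castSucc⟩ := this
        exact V.primeSpectrumOrderEquiv.symm.lt_iff_lt.2 h2 }
  exact Order.LTSeries.length_le_krullDim r

theorem ringKrullDim_le_valuativeDim {R L : Type*} [CommRing R] [IsDomain R] [Field L]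
    [Algebra R L] [IsFractionRing R L] (V : ValuationSubring L) (hV : ∀ r, algebraMap R L r ∈ V) :
    ringKrullDim V ≤ valuativeDim R := by
  let e : FractionRing R ≃ₐ[R] L := FractionRing.algEquiv R L
  let W : ValuationSubring (FractionRing R) := V.comap (e : FractionRing R →+* L)
  let W' : Subalgebra R (FractionRing R) :=
    { W.toSubring with
      algebraMap_mem' := fun r => by
        change e (algebraMap R _ r) ∈ V
        simpa using hV r }
  have hval : ValuationRing W' := inferInstanceAs (ValuationRing W)
  let φ : W' →+* V := ((e : FractionRing R →+* L).comp W'.val.toRingHom).codRestrict V.toSubring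
    fun w => w.2
  have hφ : Function.Bijective φ := by
    refine ⟨fun a b h => Subtype.ext (e.injective (congrArg Subtype.val h)), fun v => ?_⟩
    refine ⟨⟨e.symm v, ?_⟩, Subtype.ext (e.apply_symm_apply _)⟩
    change e (e.symm v) ∈ V
    simp
  rw [← ringKrullDim_eq_of_ringEquiv (RingEquiv.ofBijective φ hφ)]
  exact le_iSup₂ (f := fun (V : Subalgebra R (FractionRing R)) (_ : ValuationRing V) =>
    ringKrullDim V) W' hval

theorem length_le_valuativeDim {R L A : Type*} [CommRing R] [IsDomain R] [Field L]
    [Algebra R L] [IsFractionRing R L] [CommRing A] [Algebra R A] (f : A →+* L)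
    (hf : f.comp (algebraMap R A) = algebraMap R L) (p : LTSeries (PrimeSpectrum A))
    (hp : RingHom.ker f ≤ p.head.asIdeal) : (p.length : WithBot ℕ∞) ≤ valuativeDim R := by
  obtain ⟨q, hq, hq1, -⟩ := exists_ltSeries_valuationSubring f p hp
  rw [← hq]
  refine (ValuationSubring.length_le_ringKrullDim q).trans
    (ringKrullDim_le_valuativeDim (R := R) (OrderDual.ofDual q.last) fun r => ?_)
  rw [← hf]
  exact hq1 _

section ResiduePullback

open IsLocalRing

variable {S : Type*} [CommRing S] [IsLocalRing S] (k : Subfield (ResidueField S))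

/-- The preimage in a local ring `S` of a subfield `k` of its residue field. -/
abbrev residuePullback : Subring S := k.toSubring.comap (residue S)

theorem mem_residuePullback_of_mem_maximalIdeal {s : S} (hs : s ∈ maximalIdeal S) :
    s ∈ residuePullback k := by
  rw [Subring.mem_comap, (residue_eq_zero_iff s).2 hs]
  exact zero_mem _

theorem isUnit_residuePullback {r : residuePullback k} (hr : (r : S) ∉ maximalIdeal S) :
    IsUnit r := by
  obtain ⟨v, hv⟩ := isUnit_iff_exists_inv.1 (notMem_maximalIdeal.1 hr)
  have h1 : residue S r * residue S v = 1 := by rw [← map_mul, hv, map_one]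
  have hvk : v ∈ residuePullback k := by
    rw [Subring.mem_comap, eq_inv_of_mul_eq_one_right h1]
    exact k.inv_mem r.2
  exact IsUnit.of_mul_eq_one ⟨v, hvk⟩ (Subtype.ext hv)

/-- For an ideal `p` of the pullback ring, the ideal of those `s` such that `s • 𝔪 ⊆ p`. -/
def colonMaximalIdeal (p : Ideal (residuePullback k)) : Ideal S where
  carrier := {s | ∀ (m : S) (hm : m ∈ maximalIdeal S),
    (⟨s * m, mem_residuePullback_of_mem_maximalIdeal k (Ideal.mul_mem_left _ s hm)⟩ :
      residuePullback k) ∈ p}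
  add_mem' {a b} ha hb m hm := by
    convert p.add_mem (ha m hm) (hb m hm) using 1
    exact Subtype.ext (add_mul _ _ _)
  zero_mem' m hm := by
    convert p.zero_mem using 1
    exact Subtype.ext (zero_mul _)
  smul_mem' c s hs m hm := by
    convert hs (c * m) (Ideal.mul_mem_left _ c hm) using 1
    exact Subtype.ext (by simp only [smul_eq_mul]; ring)

theorem comap_colonMaximalIdeal {p : Ideal (residuePullback k)} [p.IsPrime]
    (hp : ¬ (maximalIdeal S).comap (residuePullback k).subtype ≤ p) :
    (colonMaximalIdeal k p).comap (residuePullback k).subtype = p := by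
  obtain ⟨m, hm, hmp⟩ := SetLike.not_le_iff_exists.1 hp
  ext r
  refine ⟨fun h => ?_, fun h n hn => ?_⟩
  · exact (Ideal.IsPrime.mem_or_mem ‹p.IsPrime› (x := r) (y := m) (h m hm)).resolve_right hmp
  · exact p.mul_mem_right ⟨n, mem_residuePullback_of_mem_maximalIdeal k hn⟩ h

theorem colonMaximalIdeal_isPrime {p : Ideal (residuePullback k)} [p.IsPrime]
    (hp : ¬ (maximalIdeal S).comap (residuePullback k).subtype ≤ p) :
    (colonMaximalIdeal k p).IsPrime := by
  refine ⟨fun h => ?_, fun {a b} hab => ?_⟩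
  · have := comap_colonMaximalIdeal k hp
    rw [h, Ideal.comap_top] at this
    exact Ideal.IsPrime.ne_top ‹_› this.symm
  · refine or_iff_not_imp_left.2 fun ha n hn => ?_
    change ¬ ∀ _ _, _ at ha
    push Not at ha
    obtain ⟨m, hm, ham⟩ := ha
    refine (Ideal.IsPrime.mem_or_mem ‹p.IsPrime› ?_).resolve_left ham
    convert p.mul_mem_right ⟨n, mem_residuePullback_of_mem_maximalIdeal k hn⟩ (hab m hm) using 1
    exact Subtype.ext (by simp only [Subring.coe_mul]; ring)

open Classical in
/-- The prime of `S` lying over a given prime of the pullback ring. -/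
noncomputable def primeOverResiduePullback (p : PrimeSpectrum (residuePullback k)) :
    PrimeSpectrum S :=
  if hp : (maximalIdeal S).comap (residuePullback k).subtype ≤ p.asIdeal then closedPoint S
  else ⟨colonMaximalIdeal k p.asIdeal, colonMaximalIdeal_isPrime k hp⟩

theorem comap_primeOverResiduePullback (p : PrimeSpectrum (residuePullback k)) :
    (primeOverResiduePullback k p).comap (residuePullback k).subtype = p := by
  apply PrimeSpectrum.ext
  rw [primeOverResiduePullback]
  split_ifs with hp
  · refine le_antisymm hp fun r hr => ?_
    by_contra h
    exact p.2.ne_top (Ideal.eq_top_of_isUnit_mem _ hr (isUnit_residuePullback k h))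
  · exact comap_colonMaximalIdeal k hp

theorem primeOverResiduePullback_strictMono : StrictMono (primeOverResiduePullback k) := by
  refine Monotone.strictMono_of_injective (fun p q hpq => ?_)
    (Function.LeftInverse.injective (comap_primeOverResiduePullback k))
  by_cases hq : (maximalIdeal S).comap (residuePullback k).subtype ≤ q.asIdeal
  · rw [primeOverResiduePullback.eq_1 k q, dif_pos hq]
    exact le_maximalIdeal (primeOverResiduePullback k p).2.ne_top
  · have hp : ¬ (maximalIdeal S).comap (residuePullback k).subtype ≤ p.asIdeal :=
      fun h => hq (h.trans hpq)
    rw [primeOverResiduePullback, primeOverResiduePullback, dif_neg hq, dif_neg hp]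
    exact fun s hs m hm => hpq (hs m hm)

/-- If `residue S u` is transcendental over `k` and a polynomial `f` over the pullback ring has
`f(u)` in the maximal ideal, then all coefficients of `f` lie in the maximal ideal. -/
theorem coeff_mem_of_aeval_mem_maximalIdeal {u : S} (hu : Transcendental k (residue S u))
    {f : (residuePullback k)[X]} (hf : aeval u f ∈ maximalIdeal S) (n : ℕ) :
    (f.coeff n : S) ∈ maximalIdeal S := by
  let g : residuePullback k →+* k :=
    ((residue S).comp (residuePullback k).subtype).codRestrict k.toSubring fun r => r.2
  have h1 : aeval (residue S u) (f.map g) = 0 := by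
    rw [← (residue_eq_zero_iff _).2 hf, aeval_def, eval₂_map, aeval_def, hom_eval₂]
    rfl
  have h2 : f.map g = 0 := by
    by_contra h
    exact hu ⟨_, h, h1⟩
  have h3 : g (f.coeff n) = 0 := by rw [← coeff_map, h2, coeff_zero]
  exact (residue_eq_zero_iff _).1 (congrArg Subtype.val h3)

theorem exists_ltSeries_polynomial_residuePullback {u : S} (hu : Transcendental k (residue S u))
    (p : LTSeries (PrimeSpectrum (residuePullback k))) :
    ∃ q : LTSeries (PrimeSpectrum (residuePullback k)[X]), q.length = p.length + 1 ∧
      RingHom.ker (aeval (R := residuePullback k) u) ≤ q.head.asIdeal := by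
  let φ : (residuePullback k)[X] →+* S := (aeval u).toRingHom
  let Φ : PrimeSpectrum (residuePullback k) → PrimeSpectrum (residuePullback k)[X] :=
    fun P => (primeOverResiduePullback k P).comap φ
  have hφC : φ.comp C = (residuePullback k).subtype := RingHom.ext fun r => aeval_C u r
  have hΦ : StrictMono Φ := by
    refine Monotone.strictMono_of_injective (fun P P' h => ?_) ?_
    · exact Ideal.comap_mono ((primeOverResiduePullback_strictMono k).monotone h)
    · refine Function.LeftInverse.injective (g := PrimeSpectrum.comap C) fun P => ?_
      rw [← PrimeSpectrum.comap_comp_apply, hφC, comap_primeOverResiduePullback]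
  let N : PrimeSpectrum (residuePullback k)[X] :=
    (closedPoint S).comap ((residuePullback k).subtype.comp constantCoeff)
  have hle : ∀ P f, f ∈ (Φ P).asIdeal → aeval u f ∈ maximalIdeal S := fun P f hf =>
    le_maximalIdeal (primeOverResiduePullback k P).2.ne_top hf
  have hN : ∀ P, Φ P < N := by
    intro P
    refine lt_of_le_of_ne (fun f hf => ?_) fun h => ?_
    · exact coeff_mem_of_aeval_mem_maximalIdeal k hu (hle P f hf) 0
    · have hX : (X : (residuePullback k)[X]) ∈ N.asIdeal := by
        change ((constantCoeff (X : (residuePullback k)[X]) : residuePullback k) : S) ∈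
          maximalIdeal S
        simp
      rw [← h] at hX
      have h0 := hle P X hX
      rw [aeval_X, ← residue_eq_zero_iff] at h0
      exact hu (h0 ▸ isAlgebraic_zero)
  refine ⟨(p.map Φ hΦ).snoc N (by rw [LTSeries.last_map]; exact hN _), by simp, ?_⟩
  rw [RelSeries.head_snoc, LTSeries.head_map]
  intro f hf
  change aeval u f ∈ (primeOverResiduePullback k p.head).asIdeal
  rw [(RingHom.mem_ker).1 hf]
  exact zero_mem _

theorem isFractionRing_residuePullback [IsDomain S] (hS : maximalIdeal S ≠ ⊥) :
    IsFractionRing (residuePullback k) (FractionRing S) := by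
  obtain ⟨m, hm, hm0⟩ := Submodule.exists_mem_ne_zero_of_ne_bot hS
  have : FaithfulSMul (residuePullback k) (FractionRing S) :=
    (faithfulSMul_iff_algebraMap_injective _ _).2
      ((IsFractionRing.injective S (FractionRing S)).comp Subtype.val_injective)
  refine IsFractionRing.of_field _ _ fun z => ?_
  obtain ⟨a, b, hb, rfl⟩ := IsFractionRing.div_surjective (A := S) z
  refine ⟨⟨a * m, mem_residuePullback_of_mem_maximalIdeal k (Ideal.mul_mem_left _ a hm)⟩,
    ⟨b * m, mem_residuePullback_of_mem_maximalIdeal k (Ideal.mul_mem_left _ b hm)⟩, ?_⟩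
  have hm0' : algebraMap S (FractionRing S) m ≠ 0 := by simpa using hm0
  change _ = algebraMap S (FractionRing S) (a * m) / algebraMap S (FractionRing S) (b * m)
  rw [map_mul, map_mul, mul_div_mul_right _ _ hm0']

/-- A transcendental element of the residue field makes the valuative dimension of the pullback
ring exceed its Krull dimension. -/
theorem add_one_le_valuativeDim_residuePullback [IsDomain S] (hS : maximalIdeal S ≠ ⊥)
    {t : ResidueField S} (ht : Transcendental k t) {n : ℕ}
    (hn : n ≤ ringKrullDim (residuePullback k)) :
    ((n + 1 : ℕ) : WithBot ℕ∞) ≤ valuativeDim (residuePullback k) := by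
  have := isFractionRing_residuePullback k hS
  obtain ⟨u, rfl⟩ := residue_surjective t
  obtain ⟨p, rfl⟩ := Order.le_krullDim_iff.1 hn
  obtain ⟨q, hq, hker⟩ := exists_ltSeries_polynomial_residuePullback k ht p
  rw [← hq]
  refine length_le_valuativeDim (L := FractionRing S)
    ((algebraMap S (FractionRing S)).comp (aeval u).toRingHom) ?_ q fun f hf => hker ?_
  · ext r
    simp [← IsScalarTower.algebraMap_apply]
  · exact IsFractionRing.injective S (FractionRing S) (by simpa using hf)

end ResiduePullback

/-- If `T_Q` is a field then the residue fields `k(q)` and `k(Q)` coincide. -/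
theorem kqSub_eq_top_of_maximalIdeal_eq_bot (D : Type*) [CommRing D] [IsDomain D]
    (T : Subalgebra D (FractionRing D)) (Q : Ideal T) [Q.IsPrime]
    (h : IsLocalRing.maximalIdeal (Localization.AtPrime Q) = ⊥) : kqSub D T Q = ⊤ := by
  have hinj : Function.Injective (IsLocalRing.residue (Localization.AtPrime Q)) := by
    rw [RingHom.injective_iff_ker_eq_bot, IsLocalRing.ker_residue, h]
  let φ : T →+* IsLocalRing.ResidueField (Localization.AtPrime Q) :=
    (IsLocalRing.residue (Localization.AtPrime Q)).comp (algebraMap T (Localization.AtPrime Q))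
  have hφ : Function.Injective φ := hinj.comp
    (IsLocalization.injective (Localization.AtPrime Q) Q.primeCompl_le_nonZeroDivisors)
  have hD : ∀ d : D, φ (algebraMap D T d) ∈ kqSub D T Q := fun d =>
    Subfield.subset_closure ⟨d, rfl⟩
  have hT : ∀ t : T, φ t ∈ kqSub D T Q := by
    intro t
    obtain ⟨a, b, hb, hab⟩ := IsFractionRing.div_surjective (A := D) (t : FractionRing D)
    have hb0 : b ≠ 0 := nonZeroDivisors.ne_zero hb
    have hinjD : Function.Injective (algebraMap D T) := fun x y hxy =>
      IsFractionRing.injective D (FractionRing D) (congrArg Subtype.val hxy)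
    have h1 : t * algebraMap D T b = algebraMap D T a := by
      apply Subtype.ext
      change (t : FractionRing D) * algebraMap D _ b = algebraMap D _ a
      rw [← hab, div_mul_cancel₀]
      simpa using hb0
    have h2 : φ (algebraMap D T b) ≠ 0 := by
      rw [← map_zero φ]
      exact fun h => hb0 (hinjD ((hφ h).trans (map_zero _).symm))
    have h3 : φ t = φ (algebraMap D T a) / φ (algebraMap D T b) := by
      rw [eq_div_iff h2, ← map_mul, h1]
    rw [h3]
    exact div_mem (hD a) (hD b)
  refine eq_top_iff.2 fun x _ => ?_
  obtain ⟨s, rfl⟩ := IsLocalRing.residue_surjective x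
  obtain ⟨a, b, rfl⟩ := IsLocalization.exists_mk'_eq Q.primeCompl s
  have h1 := congrArg (IsLocalRing.residue _)
    (IsLocalization.mk'_spec (Localization.AtPrime Q) a b)
  rw [map_mul] at h1
  have h2 : IsLocalRing.residue _ (algebraMap T (Localization.AtPrime Q) b) ≠ 0 :=
    ((IsLocalization.map_units (Localization.AtPrime Q) b).map (IsLocalRing.residue _)).ne_zero
  rw [eq_div_of_mul_eq h2 h1]
  exact div_mem (hT a) (hT b)

/-- If the pullback `D(Q)` is a Jaffard domain (finite dimensional with
`dim D(Q) = dim_v D(Q)`) and `dim_v T_Q < ∞`, then `k(Q)` is algebraic over `k(q)`. -/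
theorem statement_8 (D : Type*) [CommRing D] [IsDomain D]
    (T : Subalgebra D (FractionRing D)) (Q : Ideal T) [Q.IsPrime]
    (hJ : ringKrullDim (DQ D T Q) = valuativeDim (DQ D T Q))
    (hfin : valuativeDim (DQ D T Q) < ⊤)
    (hfinT : valuativeDim (Localization.AtPrime Q) < ⊤) :
    Algebra.IsAlgebraic (kqSub D T Q)
      (IsLocalRing.ResidueField (Localization.AtPrime Q)) := by
  by_cases hM : IsLocalRing.maximalIdeal (Localization.AtPrime Q) = ⊥
  · refine ⟨fun x => ?_⟩
    have hx : x ∈ kqSub D T Q := by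
      rw [kqSub_eq_top_of_maximalIdeal_eq_bot D T Q hM]
      trivial
    exact isAlgebraic_algebraMap (⟨x, hx⟩ : kqSub D T Q)
  · by_contra hna
    obtain ⟨t, ht⟩ : ∃ t, Transcendental (kqSub D T Q) t := by
      by_contra! h
      exact hna ⟨fun x => not_not.1 (h x)⟩
    have h0 : valuativeDim (DQ D T Q) ≠ ⊥ := by
      rw [← hJ]
      exact ((WithBot.bot_lt_coe 0).trans_le ringKrullDim_nonneg_of_nontrivial).ne'
    obtain ⟨n, hn⟩ : ∃ n : ℕ, valuativeDim (DQ D T Q) = n := by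
      generalize valuativeDim (DQ D T Q) = d at h0 hfin
      induction d with
      | bot => exact absurd rfl h0
      | coe d =>
        induction d with
        | top => exact absurd rfl hfin.ne
        | coe n => exact ⟨n, rfl⟩
    have h1 : ((n + 1 : ℕ) : WithBot ℕ∞) ≤ valuativeDim (DQ D T Q) :=
      add_one_le_valuativeDim_residuePullback (kqSub D T Q) hM ht (hn.symm.trans hJ.symm).le
    rw [hn] at h1
    exact absurd (by exact_mod_cast h1) (Nat.not_succ_le_self n)
end

section
/- An integral domain D is quasi-Prüfer if and only if for every prime ideal Q of D[X] with Q ∩ D ≠ 0 contained in some P[X] for P prime of D, the integral closure condition holds: equivalently, the integral closure D' of D in its fraction field is a Prüfer domain. -/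
set_option synthInstance.maxHeartbeats 1000000
set_option maxHeartbeats 1000000

open Polynomial

namespace Polynomial

variable {R K : Type*} [CommRing R] [Field K] [Algebra R K]

/-- The ideal `J + tJ` of `R`, where `J = {x ∈ R | t x ∈ R}`. -/
def conductorSum (R : Type*) {K : Type*} [CommRing R] [Field K] [Algebra R K] (t : K) :
    Ideal R where
  carrier := {r | ∃ x y x' y' : R, algebraMap R K y = t * algebraMap R K x ∧
    algebraMap R K y' = t * algebraMap R K x' ∧ r = x + y'}
  zero_mem' := ⟨0, 0, 0, 0, by simp⟩
  add_mem' := by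
    rintro _ _ ⟨x, y, x', y', h, h', rfl⟩ ⟨u, v, u', v', k, k', rfl⟩
    exact ⟨x + u, y + v, x' + u', y' + v', by simp [h, k, mul_add], by simp [h', k', mul_add],
      by ring⟩
  smul_mem' := by
    rintro c _ ⟨x, y, x', y', h, h', rfl⟩
    exact ⟨c * x, c * y, c * x', c * y', by simp [h, mul_left_comm], by simp [h', mul_left_comm],
      by simp [mul_add]⟩

theorem coeff_mem_conductorSum [IsFractionRing R K] [IsIntegrallyClosed R] {t : K} (f : R[X])
    (hf : aeval t f = 0) (i : ℕ) : f.coeff i ∈ conductorSum R t := by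
  induction hn : f.natDegree using Nat.strong_induction_on generalizing f i with
  | _ n ih =>
  obtain ⟨b, hb⟩ := IsIntegrallyClosed.isIntegral_iff.mp (isIntegral_leadingCoeff_smul f t hf)
  rw [Algebra.smul_def, mul_comm] at hb
  have hlead : f.leadingCoeff ∈ conductorSum R t := ⟨f.leadingCoeff, b, 0, 0, hb, by simp, by simp⟩
  have hb_mem : b ∈ conductorSum R t := ⟨0, 0, f.leadingCoeff, b, by simp, hb, by simp⟩
  obtain _ | m := n
  · obtain _ | i := i
    · rwa [leadingCoeff, hn] at hlead
    · rw [coeff_eq_zero_of_natDegree_lt (by lia)]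
      exact zero_mem _
  · set g : R[X] := f.eraseLead + monomial m b with hg
    have hfg : f = f.eraseLead + monomial (m + 1) f.leadingCoeff := by
      rw [← hn, eraseLead_add_monomial_natDegree_leadingCoeff]
    have hg0 : aeval t g = 0 := by
      have : aeval t f = aeval t f.eraseLead + f.leadingCoeff • t ^ (m + 1) := by
        conv_lhs => rw [hfg]
        simp [aeval_monomial, Algebra.smul_def]
      rw [← hf, this, hg, map_add, aeval_monomial, hb, Algebra.smul_def]
      ring
    have hdeg : g.natDegree < m + 1 := by
      have h1 := f.eraseLead_natDegree_le
      have h2 := natDegree_monomial_le (R := R) b (m := m)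
      have h3 := natDegree_add_le f.eraseLead (monomial m b)
      rw [← hg] at h3
      lia
    have hcoeff : f.coeff i =
        g.coeff i - (monomial m b).coeff i + (monomial (m + 1) f.leadingCoeff).coeff i := by
      conv_lhs => rw [hfg]
      simp [hg]
    rw [hcoeff]
    refine add_mem (sub_mem (ih _ hdeg g hg0 i rfl) ?_) ?_ <;> rw [coeff_monomial] <;> split_ifs
    exacts [hb_mem, zero_mem _, hlead, zero_mem _]

end Polynomial

section Invertible

variable {R : Type*} [CommRing R] [IsDomain R]

theorem isUnit_coeIdeal_of_mul_eq_span_singleton {I J : Ideal R} {q : R} (hq : q ≠ 0)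
    (h : I * J = Ideal.span {q}) :
    IsUnit (I : FractionalIdeal (nonZeroDivisors R) (FractionRing R)) := by
  refine isUnit_of_mul_isUnit_left (y := (J : FractionalIdeal (nonZeroDivisors R) (FractionRing R)))
    ?_
  rw [← FractionalIdeal.coeIdeal_mul, h]
  exact .of_mul_eq_one _ (FractionalIdeal.coe_ideal_span_singleton_mul_inv (FractionRing R) hq)

theorem exists_mul_eq_span_singleton_of_isUnit {I : Ideal R}
    (h : IsUnit (I : FractionalIdeal (nonZeroDivisors R) (FractionRing R))) :
    ∃ (J : Ideal R) (q : R), q ≠ 0 ∧ I * J = Ideal.span {q} := by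
  obtain ⟨L, hL⟩ := h.exists_right_inv
  obtain ⟨q, J, hq, rfl⟩ := FractionalIdeal.exists_eq_spanSingleton_mul L
  refine ⟨J, q, hq, ?_⟩
  apply FractionalIdeal.coeIdeal_injective (K := FractionRing R)
  beta_reduce
  have hq' : algebraMap R (FractionRing R) q ≠ 0 := by simpa using hq
  rw [FractionalIdeal.coeIdeal_span_singleton, FractionalIdeal.coeIdeal_mul,
    ← mul_one (FractionalIdeal.spanSingleton _ _), ← hL, mul_left_comm,
    ← mul_assoc (FractionalIdeal.spanSingleton _ _),
    FractionalIdeal.spanSingleton_mul_spanSingleton, mul_inv_cancel₀ hq',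
    FractionalIdeal.spanSingleton_one, one_mul]

/-- If all nonzero two-generated ideals are invertible, the domain is Prüfer. -/
theorem isPruferDom_of_pair
    (h : ∀ p q : R, q ≠ 0 →
      IsUnit (Ideal.span {p, q} : FractionalIdeal (nonZeroDivisors R) (FractionRing R))) :
    IsPruferDom R := by
  have hpair (p q : R) (hne : Ideal.span {p, q} ≠ ⊥) :
      IsUnit (Ideal.span {p, q} : FractionalIdeal (nonZeroDivisors R) (FractionRing R)) := by
    by_cases hq : q = 0
    · have hp : p ≠ 0 := by
        rintro rfl
        simp [hq] at hne
      rw [Set.pair_comm]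
      exact h q p hp
    · exact h p q hq
  classical
  have key (s : Finset R) : ∀ a : R, Ideal.span (insert a (s : Set R)) ≠ ⊥ →
      IsUnit (Ideal.span (insert a (s : Set R)) :
        FractionalIdeal (nonZeroDivisors R) (FractionRing R)) := by
    induction s using Finset.induction_on with
    | empty =>
      intro a ha
      simpa using hpair a a (by simpa using ha)
    | insert b s _ ih =>
      intro a hne
      rw [Finset.coe_insert] at hne ⊢
      have hab := Ideal.span_insert a ({b} : Set R)
      have hbs := Ideal.span_insert b (s : Set R)
      have has := Ideal.span_insert a (s : Set R)
      have habs : Ideal.span (insert a (insert b (s : Set R))) =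
          Ideal.span {a} ⊔ Ideal.span {b} ⊔ Ideal.span (s : Set R) := by
        rw [Ideal.span_insert, Ideal.span_insert, sup_assoc]
      have hab' := hpair a b
      have hbs' := ih b
      have has' := ih a
      rw [hab] at hab'
      rw [hbs] at hbs'
      rw [has] at has'
      rw [habs] at hne ⊢
      generalize Ideal.span {a} = A at *
      generalize Ideal.span {b} = B at *
      generalize Ideal.span (s : Set R) = S at *
      by_cases h1 : A ⊔ B = ⊥
      · rw [sup_eq_bot_iff] at h1
        obtain ⟨rfl, rfl⟩ := h1
        simpa using hbs' (by simpa using hne)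
      by_cases h2 : B ⊔ S = ⊥
      · rw [sup_eq_bot_iff] at h2
        obtain ⟨rfl, rfl⟩ := h2
        simpa using hab' (by simpa using hne)
      by_cases h3 : A ⊔ S = ⊥
      · rw [sup_eq_bot_iff] at h3
        obtain ⟨rfl, rfl⟩ := h3
        simpa using hab' (by simpa using hne)
      have hprod : (A ⊔ B) * (B ⊔ S) * (A ⊔ S) = (A ⊔ B ⊔ S) * (A * B ⊔ B * S ⊔ A * S) := by
        simp only [← Ideal.add_eq_sup]
        have hidem (I : Ideal R) : I + I = I := by simp
        calc (A + B) * (B + S) * (A + S)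
            = A * A * B + A * A * S + A * B * B + B * B * S + A * S * S + B * S * S
              + (A * B * S + A * B * S) := by ring
          _ = A * A * B + A * A * S + A * B * B + B * B * S + A * S * S + B * S * S
              + (A * B * S + A * B * S + A * B * S) := by simp only [hidem]
          _ = _ := by ring
      have hu := ((hab' h1).mul (hbs' h2)).mul (has' h3)
      rw [← FractionalIdeal.coeIdeal_mul, ← FractionalIdeal.coeIdeal_mul, hprod,
        FractionalIdeal.coeIdeal_mul] at hu
      exact isUnit_of_mul_isUnit_left hu
  rintro I hI ⟨s, rfl⟩
  have hs : Ideal.span (s : Set R) = Ideal.span (insert 0 (s : Set R)) := by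
    rw [Ideal.span_insert_zero]
  change IsUnit (Ideal.span (s : Set R) : FractionalIdeal (nonZeroDivisors R) (FractionRing R))
  rw [hs]
  exact key s 0 (hs ▸ hI)

theorem isPruferDom_of_one_mem_conductorSum (K : Type*) [Field K] [Algebra R K]
    [IsFractionRing R K] (h : ∀ t : K, 1 ∈ conductorSum R t) : IsPruferDom R := by
  refine isPruferDom_of_pair fun p q hq ↦ ?_
  have hq' : algebraMap R K q ≠ 0 := by simpa using hq
  obtain ⟨x, y, x', y', h, h', h1⟩ := h (algebraMap R K p / algebraMap R K q)
  have e : p * x = q * y := by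
    apply IsFractionRing.injective R K
    rw [map_mul, map_mul, h]
    field_simp
  have e' : p * x' = q * y' := by
    apply IsFractionRing.injective R K
    rw [map_mul, map_mul, h']
    field_simp
  refine isUnit_coeIdeal_of_mul_eq_span_singleton (J := Ideal.span {x, x'}) hq (le_antisymm ?_ ?_)
  · rw [Ideal.span_pair_mul_span_pair, Ideal.span_le]
    rintro _ (rfl | rfl | rfl | rfl) <;> rw [SetLike.mem_coe, Ideal.mem_span_singleton]
    exacts [⟨y, e⟩, ⟨y', e'⟩, dvd_mul_right _ _, dvd_mul_right _ _]
  · rw [Ideal.span_singleton_le_iff_mem]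
    have : q = q * x + p * x' := by rw [e', ← mul_add, ← h1, mul_one]
    have hmem : q * x + p * x' ∈ Ideal.span {p, q} * Ideal.span {x, x'} :=
      add_mem (Ideal.mul_mem_mul (Ideal.subset_span (by simp)) (Ideal.subset_span (by simp)))
        (Ideal.mul_mem_mul (Ideal.subset_span (by simp)) (Ideal.subset_span (by simp)))
    rwa [← this] at hmem

/-- A Prüfer domain is quasi-Prüfer. -/
theorem IsPruferDom.isQuasiPrufer (h : IsPruferDom R) : IsQuasiPrufer R := by
  intro P hP Q hQ hQP
  refine le_antisymm (fun f hf ↦ ?_) (Ideal.map_comap_le)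
  rw [Ideal.mem_map_C_iff]
  intro k
  rw [Ideal.mem_comap]
  by_cases hf0 : f = 0
  · simp [hf0]
  obtain ⟨J, q, hq, hJ⟩ := exists_mul_eq_span_singleton_of_isUnit
    (h f.contentIdeal (by simpa using hf0) f.contentIdeal_FG)
  have hdvd {b : R} (hb : b ∈ J) (i : ℕ) : q ∣ f.coeff i * b := by
    rw [← Ideal.mem_span_singleton, ← hJ]
    exact Ideal.mul_mem_mul (f.coeff_mem_contentIdeal i) hb
  obtain ⟨b, hb, i, hi⟩ : ∃ b ∈ J, ∃ i, f.coeff i * b ∉ Ideal.span {q} * P := by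
    by_contra! hall
    have hle : Ideal.span {q} ≤ Ideal.span {q} * P := by
      conv_lhs => rw [← hJ, contentIdeal_def]
      rw [← Ideal.span_eq J, Ideal.span_mul_span', Ideal.span_le]
      rintro _ ⟨a, ha, b, hb, rfl⟩
      obtain ⟨i, -, rfl⟩ := mem_coeffs_iff.mp ha
      exact hall b hb i
    obtain ⟨z, hz, hqz⟩ := Ideal.mem_span_singleton_mul.mp
      (hle (Ideal.mem_span_singleton_self q))
    exact hP.one_notMem ((mul_eq_left₀ hq).mp hqz ▸ hz)
  choose u hu using hdvd hb
  have hui : u i ∉ P := fun hmem ↦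
    hi (Ideal.mem_span_singleton_mul.mpr ⟨u i, hmem, (hu i).symm⟩)
  have hb0 : b ≠ 0 := by
    rintro rfl
    simp at hi
  have hcross (k : ℕ) : u i * f.coeff k = f.coeff i * u k := by
    apply mul_left_cancel₀ (mul_ne_zero hq hb0)
    linear_combination (b * f.coeff i) * hu k - (b * f.coeff k) * hu i
  have hsupp {k : ℕ} (hk : f.coeff k = 0) : u k = 0 := by
    simpa [hk, hq] using (hu k).symm
  let g : R[X] := ∑ k ∈ f.support, monomial k (u k)
  have hg (k : ℕ) : g.coeff k = u k := by
    simp only [g, finsetSum_coeff, coeff_monomial, Finset.sum_ite_eq']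
    split_ifs with hk
    · rfl
    · exact (hsupp (notMem_support_iff.mp hk)).symm
  have hCmem {a : R} (ha : a ∉ P) : C a ∉ Q := fun hmem ↦ by
    simpa using ha (by simpa using (Ideal.mem_map_C_iff.mp (hQP hmem)) 0)
  have hmul : C (f.coeff i) * g = C (u i) * f := by
    ext k
    rw [coeff_C_mul, coeff_C_mul, hg, hcross]
  have hfi : C (f.coeff i) ∈ Q := by
    refine (hQ.mem_or_mem (hmul ▸ Q.mul_mem_left _ hf)).resolve_right fun hmem ↦ hui ?_
    rw [← hg]
    exact Ideal.mem_map_C_iff.mp (hQP hmem) i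
  refine (hQ.mem_or_mem (x := C (u i)) ?_).resolve_left (hCmem hui)
  rw [← C_mul, hcross, C_mul]
  exact Q.mul_mem_right _ hfi

/-- Quasi-Prüferness descends along integral extensions. -/
theorem IsQuasiPrufer.of_isIntegral {D S : Type*} [CommRing D] [CommRing S] [Algebra D S]
    [FaithfulSMul D S] [Algebra.IsIntegral D S] (h : IsQuasiPrufer S) : IsQuasiPrufer D := by
  intro P hP Q hQ hQP
  let := Polynomial.algebra D S
  have hinj : RingHom.ker (algebraMap D[X] S[X]) = ⊥ := by
    rw [← RingHom.injective_iff_ker_eq_bot]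
    exact map_injective _ (FaithfulSMul.algebraMap_injective D S)
  obtain ⟨Q', -, hQ', rfl⟩ := Ideal.exists_ideal_over_prime_of_isIntegral Q (⊥ : Ideal S[X])
    (by rw [← RingHom.ker_eq_comap_bot, hinj]; exact bot_le)
  have hPX : (P.map (C : D →+* D[X])).IsPrime := Ideal.isPrime_map_C_of_isPrime
  obtain ⟨N, hQN, hN, hNP⟩ := Ideal.exists_ideal_over_prime_of_isIntegral_of_isPrime _ Q' hQP
  have hP' : (N.comap C).IsPrime := hN.comap C
  have hP'X : ((N.comap C).map (C : S →+* S[X])).IsPrime := Ideal.isPrime_map_C_of_isPrime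
  have hNX : N ≤ (N.comap C).map (C : S →+* S[X]) := by
    by_contra hlt
    obtain ⟨x, hxN, hx⟩ := Set.not_subset.mp hlt
    have hlt' := Ideal.comap_lt_comap_of_integral_mem_sdiff (R := D[X]) Ideal.map_comap_le
      ⟨hxN, hx⟩ (Algebra.IsIntegral.isIntegral x)
    refine hlt'.not_ge ?_
    rw [hNP, Ideal.map_le_iff_le_comap]
    intro a ha
    have haN : C a ∈ N.comap (algebraMap D[X] S[X]) := hNP ▸ Ideal.mem_map_of_mem C ha
    rw [Ideal.mem_comap, Ideal.mem_comap]
    rw [Ideal.mem_comap] at haN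
    simp only [algebraMap_def, coe_mapRingHom, map_C] at haN ⊢
    exact Ideal.mem_map_of_mem C haN
  have hQ'eq := h _ hP' Q' hQ' (hQN.trans hNX)
  refine le_antisymm (fun f hf ↦ ?_) Ideal.map_comap_le
  rw [Ideal.mem_comap, hQ'eq, Ideal.mem_map_C_iff] at hf
  rw [Ideal.mem_map_C_iff]
  intro n
  have hn := hf n
  simp only [Ideal.mem_comap, algebraMap_def, coe_mapRingHom, map_C, coeff_map] at hn ⊢
  exact hn

end Invertible

/-- `D` is quasi-Prüfer iff the integral closure `D'` of `D` in its fraction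
field is a Prüfer domain. -/
theorem statement_11 (D : Type*) [CommRing D] [IsDomain D] :
    IsQuasiPrufer D ↔ IsPruferDom (integralClosure D (FractionRing D)) := by
  have : IsFractionRing (integralClosure D (FractionRing D)) (FractionRing D) :=
    integralClosure.isFractionRing_of_finite_extension (FractionRing D) (FractionRing D)
  have : IsIntegrallyClosed (integralClosure D (FractionRing D)) :=
    integralClosure.isIntegrallyClosedOfFiniteExtension (FractionRing D)
  refine ⟨fun h ↦ isPruferDom_of_one_mem_conductorSum (FractionRing D) fun t ↦ ?_,
    fun h ↦ h.isQuasiPrufer.of_isIntegral⟩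
  rw [← Ideal.eq_top_iff_one, ← Ideal.comap_eq_top_iff
    (f := algebraMap D (integralClosure D (FractionRing D)))]
  by_contra hne
  obtain ⟨P, hP, hle⟩ := Ideal.exists_le_maximal _ hne
  let Q : Ideal D[X] := RingHom.ker (aeval t : D[X] →ₐ[D] FractionRing D)
  have hQP : Q ≤ P.map (C : D →+* D[X]) := by
    intro f hf
    rw [Ideal.mem_map_C_iff]
    intro n
    apply hle
    rw [Ideal.mem_comap, ← coeff_map]
    exact coeff_mem_conductorSum _ (by rwa [aeval_map_algebraMap]) n
  have hQ := h P hP.isPrime Q (RingHom.ker_isPrime _) hQP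
  have hbot : Q.comap (C : D →+* D[X]) = ⊥ := by
    rw [eq_bot_iff]
    intro a ha
    simpa [Q, RingHom.mem_ker] using ha
  rw [hbot, Ideal.map_bot] at hQ
  obtain ⟨f, hf0, hf⟩ := (IsFractionRing.isAlgebraic_iff D (FractionRing D) (FractionRing D)).mpr
    (isAlgebraic_algebraMap t)
  exact hf0 (by simpa using (hQ.le hf : f ∈ (⊥ : Ideal D[X])))
end

section
/- A quasilocal domain (D, m) of finite dimension is quasi-Prüfer if and only if dim(D[X]) = dim(D) + 1 and for each overring T of D and each prime Q of T lying over a prime q of D, the field k(Q) is algebraic over k(q). In particular, a quasi-Prüfer domain of finite Krull dimension is a Jaffard domain. -/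
set_option synthInstance.maxHeartbeats 1000000
set_option maxHeartbeats 1000000

open Polynomial

section QuasiPrufer

open Polynomial Ideal

/-- Every element of `K` is a root of a polynomial over `D` which does not lie in `P[X]`, for each
prime `P` of `D`. -/
def HasPrimitiveRoots (D K : Type*) [CommRing D] [CommRing K] [Algebra D K] : Prop :=
  ∀ t : K, ∀ P : Ideal D, P.IsPrime → ∃ f : D[X], aeval t f = 0 ∧ ∃ i, f.coeff i ∉ P

theorem IsQuasiPrufer.hasPrimitiveRoots {D : Type*} [CommRing D] [IsDomain D] (K : Type*) [Field K]
    [Algebra D K] [IsFractionRing D K] (h : IsQuasiPrufer D) : HasPrimitiveRoots D K := by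
  intro t P hP
  by_contra! hcon
  have hle : RingHom.ker (aeval (R := D) t) ≤ P.map (C : D →+* D[X]) := fun f hf ↦
    mem_map_C_iff.mpr (hcon f hf)
  have heq := h P hP (RingHom.ker (aeval (R := D) t)) (RingHom.ker_isPrime _) hle
  have hbot : (RingHom.ker (aeval (R := D) t)).comap (C : D →+* D[X]) = ⊥ := by
    refine (Submodule.eq_bot_iff _).mpr fun x hx ↦ ?_
    have hx' : algebraMap D K x = 0 := by simpa using hx
    exact (map_eq_zero_iff _ (IsFractionRing.injective D K)).mp hx'
  rw [hbot, Ideal.map_bot] at heq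
  obtain ⟨a, b, hb, rfl⟩ := IsFractionRing.div_surjective D t
  have hb0 : algebraMap D K b ≠ 0 :=
    (map_ne_zero_iff _ (IsFractionRing.injective D K)).mpr (nonZeroDivisors.ne_zero hb)
  have hmem : C b * X - C a ∈
      RingHom.ker (aeval (R := D) (algebraMap D K a / algebraMap D K b)) := by
    simp [RingHom.mem_ker, mul_div_cancel₀ _ hb0]
  rw [heq, Ideal.mem_bot] at hmem
  have := congrArg (coeff · 1) hmem
  simp at this
  exact nonZeroDivisors.ne_zero hb this

theorem HasPrimitiveRoots.exists_eval₂_eq_zero {D K : Type*} [CommRing D] [CommRing K] [Algebra D K]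
    (h : HasPrimitiveRoots D K) (T : Subalgebra D K) (Q : Ideal T) [Q.IsPrime] (x : T ⧸ Q) :
    ∃ p : (D ⧸ Q.comap (algebraMap D T))[X], p ≠ 0 ∧
      eval₂ (Ideal.quotientMap Q (algebraMap D T) le_rfl) x p = 0 := by
  obtain ⟨t, rfl⟩ := Ideal.Quotient.mk_surjective x
  obtain ⟨f, hf, i, hi⟩ := h t (Q.comap (algebraMap D T)) inferInstance
  refine ⟨f.map (Ideal.Quotient.mk _), fun h0 ↦ hi ?_, ?_⟩
  · have := congrArg (coeff · i) h0
    simpa [Ideal.Quotient.eq_zero_iff_mem] using this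
  · have hf' : aeval t f = 0 := by
      apply Subtype.val_injective
      simpa [← Subalgebra.aeval_coe] using hf
    rw [eval₂_map, Ideal.quotientMap_comp_mk, ← hom_eval₂, ← aeval_def, hf', map_zero]

theorem hasPrimitiveRoots_of_exists_eval₂_eq_zero {D K : Type*} [CommRing D] [CommRing K]
    [Algebra D K]
    (h : ∀ T : Subalgebra D K, ∀ Q : Ideal T, Q.IsPrime →
      ∀ x : T ⧸ Q, ∃ p : (D ⧸ Q.comap (algebraMap D T))[X], p ≠ 0 ∧
        eval₂ (Ideal.quotientMap Q (algebraMap D T) le_rfl) x p = 0) :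
    HasPrimitiveRoots D K := by
  intro t P hP
  by_contra! hcon
  let φ : D[X] →ₐ[D] (aeval (R := D) t).range := (aeval (R := D) t).rangeRestrict
  have hφ : Function.Surjective φ := AlgHom.rangeRestrict_surjective _
  have hker : RingHom.ker φ ≤ P.map (C : D →+* D[X]) := fun f hf ↦
    mem_map_C_iff.mpr (hcon f (congrArg Subtype.val hf))
  have hprime : (P.map (C : D →+* D[X])).IsPrime := isPrime_map_C_of_isPrime
  let Q : Ideal (aeval (R := D) t).range := (P.map (C : D →+* D[X])).map φ
  have hQ : Q.IsPrime := map_isPrime_of_surjective hφ hker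
  have hcomap (f : D[X]) (hf : φ f ∈ Q) : f ∈ P.map (C : D →+* D[X]) := by
    obtain ⟨g, hg, hgf⟩ := (mem_map_iff_of_surjective φ hφ).mp hf
    have : f - g ∈ RingHom.ker φ := by simp [RingHom.mem_ker, hgf]
    simpa using add_mem (hker this) hg
  obtain ⟨p, hp0, hp⟩ := h _ Q hQ (Ideal.Quotient.mk Q (φ X))
  obtain ⟨f, rfl⟩ := map_surjective _ Ideal.Quotient.mk_surjective p
  refine hp0 ?_
  rw [eval₂_map, Ideal.quotientMap_comp_mk, ← hom_eval₂, ← aeval_def, aeval_algHom_apply,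
    aeval_X_left_apply, Ideal.Quotient.eq_zero_iff_mem] at hp
  ext i
  rw [coeff_map, coeff_zero, Ideal.Quotient.eq_zero_iff_mem, mem_comap, ← φ.commutes]
  exact Ideal.mem_map_of_mem _ (Ideal.mem_map_of_mem _ (mem_map_C_iff.mp (hcomap f hp) i))

/-- Seidenberg's lemma. -/
theorem IsIntegrallyClosed.isInteger_or_isInteger_inv {A K : Type*} [CommRing A] [IsDomain A]
    [IsLocalRing A] [IsIntegrallyClosed A] [Field K] [Algebra A K] [IsFractionRing A K] {t : K}
    {f : A[X]} (hf : aeval t f = 0) {n : ℕ} (hn : f.coeff n ∉ IsLocalRing.maximalIdeal A) :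
    IsLocalization.IsInteger A t ∨ IsLocalization.IsInteger A t⁻¹ := by
  have hinj : Function.Injective (algebraMap A K) := IsFractionRing.injective A K
  induction hm : f.natDegree using Nat.strong_induction_on generalizing f n with | h m IH =>
  obtain (_ | m) := m
  · obtain ⟨r, rfl⟩ := natDegree_eq_zero.mp hm
    have hr : r = 0 := by simpa using hf
    simp [hr] at hn
  obtain ⟨b, hb⟩ := IsIntegrallyClosed.isIntegral_iff.mp (isIntegral_leadingCoeff_smul f t hf)
  rw [Algebra.smul_def] at hb
  have hlc0 : algebraMap A K f.leadingCoeff ≠ 0 := by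
    rw [map_ne_zero_iff _ hinj]
    rintro h
    rw [leadingCoeff_eq_zero.mp h] at hm
    simp at hm
  by_cases hlc : f.leadingCoeff ∈ IsLocalRing.maximalIdeal A
  · by_cases hbu : b ∈ IsLocalRing.maximalIdeal A
    · refine IH _ ?_ (f := f.eraseLead + C b * X ^ m) ?_ (n := n) ?_ rfl
      · suffices f.eraseLead.natDegree ≤ m by
          refine Nat.lt_succ_of_le ?_
          compute_degree!
        exact (eraseLead_natDegree_le ..).trans (by lia)
      · simp [← self_sub_monomial_natDegree_leadingCoeff, hf, hm, pow_succ', hb, mul_assoc]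
      · suffices f.coeff n + (if n = m then b else 0) ∉ IsLocalRing.maximalIdeal A by
          simpa [eraseLead_coeff, show n ≠ f.natDegree by rintro rfl; exact hn hlc,
            coeff_X_pow] using this
        rwa [Ideal.add_mem_iff_left]
        split_ifs
        · exact hbu
        · simp
    · right
      obtain ⟨u, rfl⟩ : IsUnit b := by simpa using hbu
      refine ⟨f.leadingCoeff * ↑u⁻¹, ?_⟩
      have hu : algebraMap A K u * algebraMap A K ↑u⁻¹ = 1 := by simp
      refine eq_inv_of_mul_eq_one_left ?_
      rw [map_mul, mul_right_comm, ← hb, hu]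
  · left
    obtain ⟨u, hu⟩ : IsUnit f.leadingCoeff := by simpa using hlc
    refine ⟨↑u⁻¹ * b, ?_⟩
    rw [map_mul, hb, ← hu, ← mul_assoc, ← map_mul]
    simp

theorem HasPrimitiveRoots.valuationRing {D A K : Type*} [CommRing D] [CommRing A]
    [Field K] [IsDomain A] [IsLocalRing A] [IsIntegrallyClosed A] [Algebra D A] [Algebra D K]
    [Algebra A K] [IsScalarTower D A K] [IsFractionRing A K] (h : HasPrimitiveRoots D K) :
    ValuationRing A := by
  refine (ValuationRing.iff_isInteger_or_isInteger A K).mpr fun t ↦ ?_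
  obtain ⟨f, hf, i, hi⟩ := h t ((IsLocalRing.maximalIdeal A).comap (algebraMap D A)) inferInstance
  refine IsIntegrallyClosed.isInteger_or_isInteger_inv (f := f.map (algebraMap D A)) (n := i) ?_ ?_
  · rwa [aeval_map_algebraMap]
  · simpa using hi

theorem HasPrimitiveRoots.valuationRing_ofField {D K : Type*} [CommRing D] [IsDomain D] [Field K]
    [Algebra D K] [IsFractionRing D K] (h : HasPrimitiveRoots D K)
    (P : Ideal (integralClosure D K)) [P.IsPrime] :
    ValuationRing
      (Localization.subalgebra.ofField K P.primeCompl P.primeCompl_le_nonZeroDivisors) := by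
  have hic : IsIntegrallyClosed (integralClosure D K) :=
    (isIntegrallyClosed_iff_isIntegrallyClosedIn K).mpr inferInstance
  have : IsIntegrallyClosed
      (Localization.subalgebra.ofField K P.primeCompl P.primeCompl_le_nonZeroDivisors) :=
    isIntegrallyClosed_of_isLocalization _ P.primeCompl P.primeCompl_le_nonZeroDivisors
  have : IsLocalRing
      (Localization.subalgebra.ofField K P.primeCompl P.primeCompl_le_nonZeroDivisors) :=
    IsLocalization.AtPrime.isLocalRing _ P
  exact h.valuationRing

/-- If the localization of a domain at a prime `P` is a valuation ring, then each nonzero polynomial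
is the product of a constant and a polynomial outside `P[X]`, up to a constant outside `P`. -/
theorem exists_C_mul_eq_C_mul_of_valuationRing {B A K : Type*} [CommRing B] [IsDomain B]
    (P : Ideal B) [P.IsPrime] [CommRing A] [IsDomain A] [ValuationRing A] [Field K] [Algebra B A]
    [Algebra A K] [IsFractionRing A K] [IsLocalization.AtPrime A P] {f : B[X]} (hf : f ≠ 0) :
    ∃ s ∉ P, ∃ c : B, ∃ g : B[X], C s * f = C c * g ∧ g ∉ P.map (C : B →+* B[X]) := by
  have hBA : Function.Injective (algebraMap B A) :=
    IsLocalization.injective A P.primeCompl_le_nonZeroDivisors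
  have hAK : Function.Injective (algebraMap A K) := IsFractionRing.injective A K
  obtain ⟨i, hi, hmax⟩ := f.support.exists_max_image
    (fun j ↦ ValuationRing.valuation A K (algebraMap A K (algebraMap B A (f.coeff j))))
    (support_nonempty.mpr hf)
  have hi0 : algebraMap A K (algebraMap B A (f.coeff i)) ≠ 0 := by
    rw [map_ne_zero_iff _ hAK, map_ne_zero_iff _ hBA]
    exact mem_support_iff.mp hi
  have hdiv (j : ℕ) : ∃ a : A, algebraMap B A (f.coeff j) = algebraMap B A (f.coeff i) * a := by
    by_cases hj : j ∈ f.support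
    · have hle : ValuationRing.valuation A K (algebraMap A K (algebraMap B A (f.coeff j)) /
          algebraMap A K (algebraMap B A (f.coeff i))) ≤ 1 := by
        rw [map_div₀]
        exact div_le_one_of_le₀ (hmax j hj) zero_le
      obtain ⟨a, ha⟩ := (ValuationRing.mem_integer_iff A K _).mp hle
      refine ⟨a, hAK ?_⟩
      rw [map_mul, ha, mul_div_cancel₀ _ hi0]
    · exact ⟨0, by simp [notMem_support_iff.mp hj]⟩
  choose a ha using hdiv
  obtain ⟨s, hs⟩ := IsLocalization.exist_integer_multiples P.primeCompl f.support a
  choose! y hy using hs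
  have key (j : ℕ) (hj : j ∈ f.support) : (s : B) * f.coeff j = f.coeff i * y j := by
    apply hBA
    rw [map_mul, map_mul, hy j hj, ha j, Algebra.smul_def]
    ring
  have hyi : y i = s :=
    (mul_left_cancel₀ (mem_support_iff.mp hi) ((mul_comm _ _).trans (key i hi))).symm
  have hcoeff (j : ℕ) : (∑ j ∈ f.support, monomial j (y j)).coeff j =
      if j ∈ f.support then y j else 0 := by
    simp [finsetSum_coeff, coeff_monomial]
  refine ⟨s, s.2, f.coeff i, ∑ j ∈ f.support, monomial j (y j), ?_, fun hmem ↦ ?_⟩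
  · ext j
    rw [coeff_C_mul, coeff_C_mul, hcoeff]
    split_ifs with hj
    · exact key j hj
    · simp [notMem_support_iff.mp hj]
  · have := mem_map_C_iff.mp hmem i
    rw [hcoeff, if_pos hi, hyi] at this
    exact s.2 this

attribute [local instance] Polynomial.algebra in
theorem HasPrimitiveRoots.isQuasiPrufer {D K : Type*} [CommRing D] [IsDomain D] [Field K]
    [Algebra D K] [IsFractionRing D K] (h : HasPrimitiveRoots D K) : IsQuasiPrufer D := by
  intro P hP Q hQ hQP
  refine le_antisymm (fun f hf ↦ ?_) map_comap_le
  let B := integralClosure D K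
  have hDB : Function.Injective (algebraMap D B) :=
    FaithfulSMul.algebraMap_injective D B
  have halg : algebraMap D[X] B[X] = mapRingHom (algebraMap D B) := rfl
  have hinj : Function.Injective (algebraMap D[X] B[X]) := by
    rw [halg]
    exact map_injective _ hDB
  obtain ⟨Q', -, hQ', hQQ'⟩ := exists_ideal_over_prime_of_isIntegral Q (⊥ : Ideal B[X])
    (by rw [← RingHom.ker_eq_comap_bot, (RingHom.injective_iff_ker_eq_bot _).mp hinj]; exact bot_le)
  have hPX : (P.map (C : D →+* D[X])).IsPrime := isPrime_map_C_of_isPrime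
  obtain ⟨N, hQN, hN, hNP⟩ := exists_ideal_over_prime_of_isIntegral_of_isPrime
    (P.map (C : D →+* D[X])) Q' (hQQ'.trans_le hQP)
  let P' : Ideal B := N.comap C
  have hP' : P'.IsPrime := inferInstance
  have hP'P : P'.comap (algebraMap D B) = P := by
    ext x
    have : C x ∈ N.comap (algebraMap D[X] B[X]) ↔ C x ∈ P.map (C : D →+* D[X]) := by rw [hNP]
    rw [mem_comap, mem_comap, ← map_C, ← coe_mapRingHom, ← halg, ← mem_comap, this, mem_map_C_iff]
    refine ⟨fun H ↦ by simpa using H 0, fun H n ↦ ?_⟩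
    rw [coeff_C]
    split_ifs
    · exact H
    · exact zero_mem _
  have hNP' : N = P'.map C := by
    have hP'X : (P'.map (C : B →+* B[X])).IsPrime := isPrime_map_C_of_isPrime
    by_contra hne
    have hlt : P'.map C < N := lt_of_le_of_ne map_comap_le (Ne.symm hne)
    have := IsIntegral.comap_lt_comap (R := D[X]) hlt
    rw [hNP] at this
    refine this.not_ge fun g hg ↦ ?_
    rw [mem_comap, halg, mem_map_C_iff]
    intro n
    rw [coe_mapRingHom, coeff_map, ← mem_comap, hP'P]
    exact mem_map_C_iff.mp hg n
  rw [mem_map_C_iff]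
  intro j
  have hf' : algebraMap D[X] B[X] f ∈ Q' := by rwa [← mem_comap, hQQ']
  rw [mem_comap, ← hQQ', mem_comap, halg, coe_mapRingHom, map_C, ← coeff_map, ← coe_mapRingHom,
    ← halg]
  generalize algebraMap D[X] B[X] f = F at hf'
  by_cases hF : F = 0
  · simp [hF]
  have := h.valuationRing_ofField P'
  obtain ⟨s, hs, c, g, hsf, hg⟩ := exists_C_mul_eq_C_mul_of_valuationRing P'
    (A := Localization.subalgebra.ofField K P'.primeCompl P'.primeCompl_le_nonZeroDivisors)
    (K := K) hF
  have hgQ : g ∉ Q' := fun H ↦ hg (hNP' ▸ hQN H)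
  have hsQ : C s ∉ Q' := fun H ↦ hs (hQN H)
  have hcQ : C c ∈ Q' := (hQ'.mem_or_mem (hsf ▸ Q'.mul_mem_left (C s) hf')).resolve_right hgQ
  refine (hQ'.mem_or_mem (x := C s) ?_).resolve_left hsQ
  have : s * F.coeff j = c * g.coeff j := by simpa using congrArg (coeff · j) hsf
  rw [← C_mul, this, C_mul]
  exact Q'.mul_mem_right _ hcQ

theorem not_lt_of_comap_C_eq {R : Type*} [CommRing R] {p : Ideal R} {N₁ N₂ N₃ : Ideal R[X]}
    [N₁.IsPrime] [N₂.IsPrime] [N₃.IsPrime] (h₁ : N₁.comap C = p) (h₂ : N₂.comap C = p)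
    (h₃ : N₃.comap C = p) (h₁₂ : N₁ < N₂) : ¬ N₂ < N₃ := by
  intro h₂₃
  have hp : p.IsPrime := h₁ ▸ inferInstance
  let q : PrimeSpectrum R := ⟨p, hp⟩
  have hdim : Order.krullDim (PrimeSpectrum.comap (C : R →+* R[X]) ⁻¹' {q}) ≤ 1 := by
    rw [show C = algebraMap R R[X] from rfl, Order.krullDim_eq_of_orderIso
      (PrimeSpectrum.preimageOrderIsoFiber R R[X] q), ← ringKrullDim,
      ← ringKrullDim_eq_of_ringEquiv (polyEquivTensor R (q.asIdeal.ResidueField)).toRingEquiv,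
      ← Nat.cast_one, ← Ring.krullDimLE_iff]
    infer_instance
  let a (N : Ideal R[X]) (hN : N.IsPrime) (h : N.comap C = p) :
      PrimeSpectrum.comap (C : R →+* R[X]) ⁻¹' {q} := ⟨⟨N, hN⟩, PrimeSpectrum.ext h⟩
  have h12 : a N₁ inferInstance h₁ < a N₂ inferInstance h₂ := h₁₂
  have h23 : a N₂ inferInstance h₂ < a N₃ inferInstance h₃ := h₂₃
  let l : LTSeries (PrimeSpectrum.comap (C : R →+* R[X]) ⁻¹' {q}) :=
    { length := 2
      toFun := ![a N₁ inferInstance h₁, a N₂ inferInstance h₂, a N₃ inferInstance h₃]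
      step := fun i ↦ by
        fin_cases i
        · exact h12
        · exact h23 }
  have hl : ((l.length : ℕ) : WithBot ℕ∞) ≤ 1 := (Order.LTSeries.length_le_krullDim l).trans hdim
  have hl2 : l.length = 2 := rfl
  rw [hl2] at hl
  exact absurd hl (by decide)

theorem IsQuasiPrufer.ringKrullDim_polynomial {D : Type*} [CommRing D] [IsDomain D]
    (hfin : ringKrullDim D < ⊤) (h : IsQuasiPrufer D) :
    ringKrullDim D[X] = ringKrullDim D + 1 := by
  classical
  refine le_antisymm ?_ ringKrullDim_succ_le_ringKrullDim_polynomial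
  have : FiniteRingKrullDim D := finiteRingKrullDim_iff_ne_bot_and_top.mpr
    ⟨((WithBot.bot_lt_coe 0).trans_le ringKrullDim_nonneg_of_nontrivial).ne', hfin.ne⟩
  let ht (N : PrimeSpectrum D[X]) : ℕ := (N.asIdeal.comap C).height.toNat
  let δ (N : PrimeSpectrum D[X]) : ℕ := if N.asIdeal = (N.asIdeal.comap C).map C then 0 else 1
  have hδ (N) : δ N ≤ 1 := by dsimp only [δ]; split_ifs <;> simp
  have hht (N) : (ht N : ℕ∞) = (N.asIdeal.comap (C : D →+* D[X])).height :=
    ENat.natCast_toNat (Ideal.height_ne_top_of_isPrime)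
  have hmono : StrictMono fun N ↦ ht N + δ N := by
    intro N' N hlt
    have hle : N'.asIdeal.comap (C : D →+* D[X]) ≤ N.asIdeal.comap C := comap_mono hlt.le
    rcases hle.lt_or_eq with hc | hc
    · have hht' : ht N' < ht N := by
        have := Ideal.height_strict_mono_of_isPrime hc
        rw [← hht, ← hht] at this
        exact_mod_cast this
      have : δ N = 0 → δ N' = 0 := by
        intro h0
        have hN : N.asIdeal = (N.asIdeal.comap C).map C := by
          by_contra hne
          simp [δ, hne] at h0
        have hNN : N'.asIdeal ≤ N.asIdeal := hlt.le
        exact if_pos (h _ inferInstance _ N'.isPrime (hNN.trans hN.le))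
      have := hδ N
      have := hδ N'
      change ht N' + δ N' < ht N + δ N
      lia
    · have hht' : ht N' = ht N := by simp only [ht, hc]
      have hN' : N'.asIdeal = (N'.asIdeal.comap C).map C := by
        by_contra hne
        have : ((N'.asIdeal.comap (C : D →+* D[X])).map C).IsPrime := isPrime_map_C_of_isPrime
        refine not_lt_of_comap_C_eq (p := N'.asIdeal.comap C) ?_ rfl hc.symm
          (lt_of_le_of_ne map_comap_le (Ne.symm hne)) hlt
        exact le_antisymm (comap_mono map_comap_le) le_comap_map
      have hN : N.asIdeal ≠ (N.asIdeal.comap C).map C := fun heq ↦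
        hlt.ne (PrimeSpectrum.ext (hN'.trans ((congrArg _ hc).trans heq.symm)))
      have h0 : δ N' = 0 := if_pos hN'
      have h1 : δ N = 1 := if_neg hN
      change ht N' + δ N' < ht N + δ N
      lia
  refine iSup_le fun l ↦ ?_
  have hl : l.length ≤ ht l.last + δ l.last :=
    (Nat.le_add_left _ _).trans (l.map _ hmono).head_add_length_le_nat
  have hlast : (ht l.last : WithBot ℕ∞) ≤ ringKrullDim D := by
    have := Ideal.height_le_ringKrullDim_of_isPrime (I := l.last.asIdeal.comap (C : D →+* D[X]))
    rwa [← hht] at this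
  calc (l.length : WithBot ℕ∞) ≤ ((ht l.last + 1 : ℕ) : WithBot ℕ∞) := by
        exact_mod_cast hl.trans (Nat.add_le_add_left (hδ _) _)
    _ = (ht l.last : WithBot ℕ∞) + 1 := by push_cast; rfl
    _ ≤ ringKrullDim D + 1 := by gcongr

theorem HasPrimitiveRoots.ringKrullDim_le {D K : Type*} [CommRing D] [CommRing K] [Algebra D K]
    (h : HasPrimitiveRoots D K) (T : Subalgebra D K) : ringKrullDim T ≤ ringKrullDim D := by
  refine Order.krullDim_le_of_strictMono (PrimeSpectrum.comap (algebraMap D T)) fun I J hIJ ↦ ?_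
  have hlt : I.asIdeal < J.asIdeal := hIJ
  obtain ⟨t, htJ, htI⟩ := SetLike.exists_of_lt hlt
  obtain ⟨f, hf, i, hi⟩ := h t (I.asIdeal.comap (algebraMap D T)) inferInstance
  refine Ideal.comap_lt_comap_of_root_mem_sdiff (p := f) hlt.le ⟨htJ, htI⟩ (fun h0 ↦ hi ?_) ?_
  · have := congrArg (coeff · i) h0
    simpa [Ideal.Quotient.eq_zero_iff_mem] using this
  · have hf' : aeval t f = 0 := by
      apply Subtype.val_injective
      simpa [← Subalgebra.aeval_coe] using hf
    rw [← aeval_def, hf']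
    exact zero_mem _

theorem ringKrullDim_le_of_isIntegral {R S : Type*} [CommRing R] [CommRing S] [Algebra R S]
    [Algebra.IsIntegral R S] [FaithfulSMul R S] : ringKrullDim R ≤ ringKrullDim S := by
  refine iSup_le fun l ↦ ?_
  obtain ⟨P, hP, hlies⟩ := Ideal.nonempty_primesOver (S := S) l.head.asIdeal
  obtain ⟨L, hL, -⟩ := Ideal.exists_ltSeries_of_hasGoingUp l P
  rw [← hL]
  exact Order.LTSeries.length_le_krullDim L

theorem HasPrimitiveRoots.ringKrullDim_le_valuativeDim {D : Type*} [CommRing D] [IsDomain D]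
    (h : HasPrimitiveRoots D (FractionRing D)) : ringKrullDim D ≤ valuativeDim D := by
  refine (ringKrullDim_le_of_isIntegral (S := integralClosure D (FractionRing D))).trans ?_
  rw [ringKrullDim_le_iff_height_le]
  intro P hP
  let A := Localization.subalgebra.ofField (FractionRing D) P.primeCompl
    P.primeCompl_le_nonZeroDivisors
  have hA : ValuationRing A := h.valuationRing_ofField P
  have hAP : IsLocalization.AtPrime A P :=
    Localization.subalgebra.isLocalization_ofField _ _ P.primeCompl_le_nonZeroDivisors
  rw [← IsLocalization.AtPrime.ringKrullDim_eq_height P A]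
  exact le_iSup₂_of_le (A.restrictScalars D) hA le_rfl

theorem IsQuasiPrufer.ringKrullDim_eq_valuativeDim {D : Type*} [CommRing D] [IsDomain D]
    (h : IsQuasiPrufer D) : ringKrullDim D = valuativeDim D :=
  le_antisymm (h.hasPrimitiveRoots _).ringKrullDim_le_valuativeDim
    (iSup₂_le fun V _ ↦ (h.hasPrimitiveRoots _).ringKrullDim_le V)

end QuasiPrufer

/-- A quasilocal domain `D` of finite dimension is quasi-Prüfer iff
`dim D[X] = dim D + 1` and every residue field extension induced by a prime of an overring
is algebraic. In particular, a quasi-Prüfer domain of finite Krull dimension is Jaffard. -/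
theorem statement_13 (D : Type*) [CommRing D] [IsDomain D] [IsLocalRing D]
    (hfin : ringKrullDim D < ⊤) :
    (IsQuasiPrufer D ↔
      (ringKrullDim D[X] = ringKrullDim D + 1 ∧
        ∀ T : Subalgebra D (FractionRing D), ∀ Q : Ideal T, Q.IsPrime →
          ∀ x : ↥T ⧸ Q, ∃ p : Polynomial (D ⧸ Q.comap (algebraMap D ↥T)), p ≠ 0 ∧
            Polynomial.eval₂ (Ideal.quotientMap Q (algebraMap D ↥T) le_rfl) x p = 0)) ∧
    (∀ (R : Type*) [CommRing R] [IsDomain R], ringKrullDim R < ⊤ → IsQuasiPrufer R →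
      ringKrullDim R = valuativeDim R) := by

  refine ⟨⟨fun h ↦ ⟨h.ringKrullDim_polynomial hfin, fun T Q _ x ↦
    (h.hasPrimitiveRoots _).exists_eval₂_eq_zero T Q x⟩, fun h ↦
    (hasPrimitiveRoots_of_exists_eval₂_eq_zero h.2).isQuasiPrufer⟩, fun R _ _ _ h ↦
    h.ringKrullDim_eq_valuativeDim⟩
end
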